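/- Suppose γ ≥ ω₁ is an L-cardinal, κ > γ is a regular cardinal, and SRP^L(γ) holds. If Z ≺ H_κ, |Z| ≤ ω₁, and γ ∈ Z, then the image γ̄ of γ under the transitive collapse of Z is an L-cardinal. -/

import Mathlib

/-!
Common set-theoretic infrastructure for formalizing the paper
"The strong reflecting property and Harrington's Principle".

We work over Mathlib's `ZFSet.{0}` (a model of ZFC).  First-order satisfaction
for the language of set theory (with two auxiliary unary predicates) is
defined directly; Gödel's constructible hierarchy `L` (and its relativized
versions `L[A]`), hereditarily-small sets `H_κ`, transitive collapses,
clubs, elementary submodels, admissible ordinals, and the various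
reflecting properties are all defined from first principles.
-/

noncomputable section
attribute [local instance] Classical.propDecidable
namespace SRPPaper

open ZFSet

/-- Image of a `ZFSet.{0}` under an arbitrary (classically definable) function. -/
def img (f : ZFSet.{0} → ZFSet.{0}) : ZFSet.{0} → ZFSet.{0} :=
  @ZFSet.image f (Classical.allZFSetDefinable _)

/-! ### First-order formulas and satisfaction -/

/-- First-order formulas in the language `{∈, =, A, B}` where `A`, `B` are
unary predicate symbols; variables are de Bruijn-style indices in `Fin n`. -/
inductive Fml : ℕ → Type
  | mem {n} (i j : Fin n) : Fml n
  | eq {n} (i j : Fin n) : Fml n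
  | inA {n} (i : Fin n) : Fml n
  | inB {n} (i : Fin n) : Fml n
  | not {n} : Fml n → Fml n
  | and {n} : Fml n → Fml n → Fml n
  | ex {n} : Fml (n + 1) → Fml n

/-- Satisfaction over the structure `(S, ∈, A, B)`; quantifiers range over `S`,
the new variable of `ex` gets index `0`. -/
def SatAB (S A B : Set ZFSet.{0}) : ∀ {n}, Fml n → (Fin n → ZFSet.{0}) → Prop
  | _, .mem i j, v => v i ∈ v j
  | _, .eq i j, v => v i = v j
  | _, .inA i, v => v i ∈ A
  | _, .inB i, v => v i ∈ B
  | _, .not φ, v => ¬ SatAB S A B φ v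
  | _, .and φ ψ, v => SatAB S A B φ v ∧ SatAB S A B ψ v
  | _, .ex φ, v => ∃ x ∈ S, SatAB S A B φ (Fin.cons x v)

/-- Pure `∈`-satisfaction over the structure `(S, ∈)`. -/
def Sat (S : Set ZFSet.{0}) {n} (φ : Fml n) (v : Fin n → ZFSet.{0}) : Prop :=
  SatAB S ∅ ∅ φ v

/-- Δ₀ (bounded) formulas. -/
inductive IsDelta0 : ∀ {n}, Fml n → Prop
  | mem {n} (i j : Fin n) : IsDelta0 (.mem i j)
  | eq {n} (i j : Fin n) : IsDelta0 (.eq i j)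
  | inA {n} (i : Fin n) : IsDelta0 (.inA i)
  | inB {n} (i : Fin n) : IsDelta0 (.inB i)
  | not {n} {φ : Fml n} : IsDelta0 φ → IsDelta0 (.not φ)
  | and {n} {φ ψ : Fml n} : IsDelta0 φ → IsDelta0 ψ → IsDelta0 (.and φ ψ)
  | bex {n} (j : Fin (n + 1)) {φ : Fml (n + 1)} : j ≠ 0 → IsDelta0 φ →
      IsDelta0 (.ex (.and (.mem 0 j) φ))

/-- A Gödel code for formulas. -/
def codeF : ∀ {n}, Fml n → ℕ
  | _, .mem i j => Nat.pair 0 (Nat.pair i.val j.val)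
  | _, .eq i j => Nat.pair 1 (Nat.pair i.val j.val)
  | _, .inA i => Nat.pair 2 i.val
  | _, .inB i => Nat.pair 3 i.val
  | _, .not φ => Nat.pair 4 (codeF φ)
  | _, .and φ ψ => Nat.pair 5 (Nat.pair (codeF φ) (codeF ψ))
  | _, .ex φ => Nat.pair 6 (codeF φ)

/-! ### Ordinals, von Neumann naturals -/

/-- `x` is a (von Neumann) ordinal: a transitive set of transitive sets. -/
def IsOrd (x : ZFSet.{0}) : Prop :=
  x.IsTransitive ∧ ∀ y ∈ x, ZFSet.IsTransitive y

/-- `x` is a limit ordinal. -/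
def IsLimitOrd (x : ZFSet.{0}) : Prop :=
  IsOrd x ∧ x ≠ ∅ ∧ ∀ y ∈ x, ∃ z ∈ x, y ∈ z

/-- The `n`-th von Neumann natural number. -/
def natZ : ℕ → ZFSet.{0}
  | 0 => ∅
  | n + 1 => insert (natZ n) (natZ n)

/-- Decoding of von Neumann naturals. -/
def zfToNat (x : ZFSet.{0}) : ℕ :=
  if h : ∃ n : ℕ, natZ n = x then h.choose else 0

/-! ### Coded functions, products -/

/-- The cartesian product of two `ZFSet.{0}`s (as a set of Kuratowski pairs). -/
def prodZ (a b : ZFSet.{0}) : ZFSet.{0} :=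
  ZFSet.sep (fun z => ∃ x, x ∈ a ∧ ∃ y, y ∈ b ∧ z = ZFSet.pair x y)
    (ZFSet.powerset (ZFSet.powerset (a ∪ b)))

/-- `f` codes a surjection from `a` onto `b`. -/
def IsSurjF (a b f : ZFSet.{0}) : Prop :=
  ZFSet.IsFunc a b f ∧ ∀ y, y ∈ b → ∃ x, x ∈ a ∧ ZFSet.pair x y ∈ f

/-- `f` codes an injection from `a` into `b`. -/
def IsInjF (a b f : ZFSet.{0}) : Prop :=
  ZFSet.IsFunc a b f ∧
    ∀ x₁, x₁ ∈ a → ∀ x₂, x₂ ∈ a → ∀ y, ZFSet.pair x₁ y ∈ f → ZFSet.pair x₂ y ∈ f → x₁ = x₂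

/-- The set of values of a coded function `f`. -/
def imageOf (f : ZFSet.{0}) : ZFSet.{0} :=
  ZFSet.sep (fun y => ∃ x, ZFSet.pair x y ∈ f) (ZFSet.sUnion (ZFSet.sUnion f))

/-! ### Cardinals (in `V`) -/

/-- `x` and `y` are equinumerous. -/
def EqNum (x y : ZFSet.{0}) : Prop := Nonempty (x.toSet ≃ y.toSet)

/-- `|x| ≤ |y|`. -/
def CardLE (x y : ZFSet.{0}) : Prop := Nonempty (x.toSet ↪ y.toSet)

/-- `|x| < κ`, for `κ` a cardinal: `x` injects into some member of `κ`. -/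
def CardLT (x κ : ZFSet.{0}) : Prop := ∃ α, α ∈ κ ∧ CardLE x α

/-- `κ` is a cardinal (of `V`). -/
def IsCard (κ : ZFSet.{0}) : Prop := IsOrd κ ∧ ∀ α ∈ κ, ¬ EqNum α κ

/-- `x` is unbounded (cofinal) in the ordinal `κ`. -/
def UnbIn (x κ : ZFSet.{0}) : Prop := ∀ β ∈ κ, ∃ γ ∈ x, β ∈ γ ∨ β = γ

/-- `κ` is a regular cardinal: every cofinal subset of `κ` has size `κ`. -/
def IsRegular (κ : ZFSet.{0}) : Prop :=
  IsCard κ ∧ ∀ x : ZFSet.{0}, x ⊆ κ → UnbIn x κ → EqNum x κ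

/-- The least ordinal satisfying `p` (junk value `∅` if there is none). -/
def leastOrd (p : ZFSet.{0} → Prop) : ZFSet.{0} :=
  if h : ∃ α, (IsOrd α ∧ p α) ∧ ∀ β ∈ α, ¬ (IsOrd β ∧ p β) then h.choose else ∅

/-- The cardinal `ℵₙ` of `V` (`Aleph 0 = ω`). -/
def Aleph : ℕ → ZFSet.{0}
  | 0 => ZFSet.omega
  | n + 1 => leastOrd (fun κ => IsCard κ ∧ Aleph n ∈ κ)

/-- The cardinal successor (in `V`) of `κ`. -/
def SuccCard (κ : ZFSet.{0}) : ZFSet.{0} := leastOrd (fun α => IsCard α ∧ κ ∈ α)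

/-- `X` is countable. -/
def Ctbl (X : ZFSet.{0}) : Prop := X.toSet.Countable

/-- `|X| = ω`: `X` is countably infinite. -/
def CtblInf (X : ZFSet.{0}) : Prop := X.toSet.Countable ∧ X.toSet.Infinite

/-! ### `H_κ`, elementary submodels, transitive collapse -/

/-- The class `H_κ` of sets hereditarily of cardinality `< κ`. -/
def Hset (κ : ZFSet.{0}) : Set ZFSet.{0} :=
  {x | ∃ t : ZFSet.{0}, t.IsTransitive ∧ x ∈ t ∧ CardLT t κ}

/-- `X ≺ S`: `X` is an elementary submodel of the class `(S, ∈)`. -/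
def ElemSub (X : ZFSet.{0}) (S : Set ZFSet.{0}) : Prop :=
  X.toSet ⊆ S ∧ ∀ {n : ℕ} (φ : Fml n) (v : Fin n → ZFSet.{0}),
    (∀ i, v i ∈ X) → (Sat X.toSet φ v ↔ Sat S φ v)

/-- The transitive-collapse map of (the ∈-structure on) `X`:
`collapse X y = {collapse X z | z ∈ y ∩ X}`.  For `γ ∈ X`, `collapse X γ` is
the image `γ̄` of `γ` under the transitive collapse of `X`. -/
def collapse (X : ZFSet.{0}) : ZFSet.{0} → ZFSet.{0} :=
  ZFSet.mem_wf.fix (C := fun _ => ZFSet.{0}) fun y ih =>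
    img (fun z => if h : z ∈ y then ih z h else ∅) (ZFSet.sep (fun z => z ∈ X) y)

/-- The transitive collapse of `X` (as a set). -/
def collapseSet (X : ZFSet.{0}) : ZFSet.{0} := img (fun y => collapse X y) X

/-- The transitive closure of (the members of) `x`. -/
def tcl : ZFSet.{0} → ZFSet.{0} :=
  ZFSet.mem_wf.fix (C := fun _ => ZFSet.{0}) fun x ih =>
    x ∪ ZFSet.sUnion (img (fun y => if h : y ∈ x then ih y h else ∅) x)

/-- The (von Neumann) rank of a set, as an ordinal `ZFSet.{0}`. -/
def rankZ : ZFSet.{0} → ZFSet.{0} :=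
  ZFSet.mem_wf.fix (C := fun _ => ZFSet.{0}) fun x ih =>
    ZFSet.sUnion (img (fun y => if h : y ∈ x then insert (ih y h) (ih y h) else ∅) x)

/-- The order type of a set `X` of ordinals: the unique ordinal `α` such that
`(X, ∈) ≅ (α, ∈)` (junk value `∅` if there is none). -/
def otype (X : ZFSet.{0}) : ZFSet.{0} :=
  if h : ∃ α, IsOrd α ∧ ∃ e : X.toSet ≃ α.toSet,
      ∀ a b : X.toSet, (a : ZFSet.{0}) ∈ (b : ZFSet.{0}) ↔ ((e a : ZFSet.{0}) ∈ (e b : ZFSet.{0}))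
  then h.choose else ∅

/-! ### The constructible hierarchy (relative to a predicate) -/

/-- The set of subsets of `X` definable over `(X, ∈, A)` with parameters. -/
def DefSetA (A : Set ZFSet.{0}) (X : ZFSet.{0}) : ZFSet.{0} :=
  ZFSet.sep (fun B => ∃ (n : ℕ) (φ : Fml (n + 1)) (v : Fin n → ZFSet.{0}),
      (∀ i, v i ∈ X) ∧ B = ZFSet.sep (fun z => SatAB X.toSet A ∅ φ (Fin.cons z v)) X)
    (ZFSet.powerset X)

/-- The hierarchy `L_α[A]`: `LstageA A α = ⋃_{β ∈ α} Def_A (LstageA A β)`. -/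
def LstageA (A : Set ZFSet.{0}) : ZFSet.{0} → ZFSet.{0} :=
  ZFSet.mem_wf.fix (C := fun _ => ZFSet.{0}) fun α ih =>
    ZFSet.sUnion (img (fun β => if h : β ∈ α then DefSetA A (ih β h) else ∅) α)

/-- Gödel's hierarchy `L_α`. -/
def Lstage : ZFSet.{0} → ZFSet.{0} := LstageA ∅

/-- The constructible universe `L`, as a class. -/
def LClass : Set ZFSet.{0} := {x | ∃ α, IsOrd α ∧ x ∈ Lstage α}

/-- The class `L[A]`, for a set `A`. -/
def LrelClass (A : ZFSet.{0}) : Set ZFSet.{0} := {x | ∃ α, IsOrd α ∧ x ∈ LstageA A.toSet α}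

/-- The constructible universe as computed inside a transitive (set or class)
model `W`: the union of the `L_α` for `α` an ordinal of `W`. -/
def LClassIn (W : Set ZFSet.{0}) : Set ZFSet.{0} :=
  {x | ∃ α, IsOrd α ∧ α ∈ W ∧ x ∈ Lstage α}

/-- `κ` is a cardinal in the (transitive) class `W`:
no coded surjection lying in `W` maps some `α < κ` onto `κ`. -/
def CardIn (W : Set ZFSet.{0}) (κ : ZFSet.{0}) : Prop :=
  IsOrd κ ∧ ∀ α, α ∈ κ → ∀ f, f ∈ W → ¬ IsSurjF α κ f

/-- `κ` is an `L`-cardinal. -/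
def LCard (κ : ZFSet.{0}) : Prop := CardIn LClass κ

/-! ### Clubs and stationarity on `[S]^ω` and on `κ` -/

/-- The union of an `ℕ`-indexed family of `ZFSet.{0}`s. -/
def seqUnion (f : ℕ → ZFSet.{0}) : ZFSet.{0} :=
  ZFSet.sUnion (img (fun m => f (zfToNat m)) ZFSet.omega)

/-- `C` is a club of countable subsets of `S`: every member is a countable
subset of `S`, `C` is `⊆`-cofinal in the countable subsets of `S`, and `C` is
closed under unions of countable increasing chains. -/
def ClubSub (S : Set ZFSet.{0}) (C : Set ZFSet.{0}) : Prop :=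
  (∀ X ∈ C, (X : ZFSet.{0}).toSet ⊆ S ∧ CtblInf X) ∧
  (∀ X : ZFSet.{0}, X.toSet ⊆ S → CtblInf X → ∃ Y ∈ C, X ⊆ Y) ∧
  (∀ f : ℕ → ZFSet.{0}, (∀ n, f n ∈ C) → (∀ n, f n ⊆ f (n + 1)) → seqUnion f ∈ C)

/-- `C` is stationary in `[S]^ω`: it meets every club of countable subsets. -/
def StatSub (S : Set ZFSet.{0}) (C : Set ZFSet.{0}) : Prop :=
  ∀ D : Set ZFSet.{0}, ClubSub S D → ∃ X, X ∈ C ∧ X ∈ D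

/-- `D` is a club (closed unbounded set) in the ordinal `κ`. -/
def ClubIn (κ D : ZFSet.{0}) : Prop :=
  D ⊆ κ ∧ (∀ β ∈ κ, ∃ θ, θ ∈ D ∧ β ∈ θ) ∧
  ∀ α, α ∈ κ → α ≠ ∅ → (∀ β ∈ α, ∃ θ, θ ∈ D ∧ θ ∈ α ∧ (β ∈ θ ∨ β = θ)) → α ∈ D

/-- `D` is stationary in the ordinal `κ`. -/
def StatIn (κ D : ZFSet.{0}) : Prop :=
  D ⊆ κ ∧ ∀ C : ZFSet.{0}, ClubIn κ C → ∃ θ, θ ∈ D ∧ θ ∈ C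

/-! ### The strong and weak reflecting properties -/

/-- `SRP^M(γ)` for an inner model given as a class `W`:  for some regular
cardinal `κ > γ`, whenever `X ≺ H_κ` is countable with `γ ∈ X`, the image of
`γ` under the transitive collapse of `X` is a cardinal of `W`. -/
def SRPclass (W : Set ZFSet.{0}) (γ : ZFSet.{0}) : Prop :=
  ∃ κ, IsRegular κ ∧ γ ∈ κ ∧
    ∀ X : ZFSet.{0}, ElemSub X (Hset κ) → CtblInf X → γ ∈ X → CardIn W (collapse X γ)

/-- `SRP^L(γ)`: the strong reflecting property for `L`-cardinals. -/
def SRPL (γ : ZFSet.{0}) : Prop := SRPclass LClass γ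

/-- `WRP^L(γ)`: the weak reflecting property for `L`-cardinals. -/
def WRPL (γ : ZFSet.{0}) : Prop :=
  ∃ κ, IsRegular κ ∧ γ ∈ κ ∧
    ∃ X : ZFSet.{0}, ElemSub X (Hset κ) ∧ CtblInf X ∧ γ ∈ X ∧ LCard (collapse X γ)

/-- `SRP^M_{<λ}(λ)`: for some regular `θ > λ`, every `X ≺ H_θ` with `|X| < λ`
and `λ ∈ X` collapses `λ` to a `W`-cardinal. -/
def SRPlt (W : Set ZFSet.{0}) (lam : ZFSet.{0}) : Prop :=
  ∃ θ, IsRegular θ ∧ lam ∈ θ ∧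
    ∀ X : ZFSet.{0}, ElemSub X (Hset θ) → CardLT X lam → lam ∈ X → CardIn W (collapse X lam)

/-! ### Notions relativized to a transitive (set or class) model `W` -/

/-- `κ` is a regular cardinal in `W`: `κ` is a `W`-cardinal and every coded
function in `W` from some `α < κ` into `κ` is bounded. -/
def RegularIn (W : Set ZFSet.{0}) (κ : ZFSet.{0}) : Prop :=
  CardIn W κ ∧ ∀ α, α ∈ κ → ∀ f, f ∈ W → ZFSet.IsFunc α κ f →
    ∃ β, β ∈ κ ∧ ∀ ξ y, ξ ∈ α → ZFSet.pair ξ y ∈ f → y ∈ β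

/-- `H_κ` as computed in `W`. -/
def HsetIn (W : Set ZFSet.{0}) (κ : ZFSet.{0}) : Set ZFSet.{0} :=
  {x | x ∈ W ∧ ∃ t, t ∈ W ∧ t.IsTransitive ∧ x ∈ t ∧
    ∃ f, f ∈ W ∧ ∃ α, α ∈ κ ∧ IsInjF t α f}

/-- `X` is countable in `W`. -/
def CtblIn (W : Set ZFSet.{0}) (X : ZFSet.{0}) : Prop :=
  X = ∅ ∨ ∃ f, f ∈ W ∧ IsSurjF ZFSet.omega X f

/-- `|X| = ω` in `W`: countable and infinite in `W`. -/
def CtblInfIn (W : Set ZFSet.{0}) (X : ZFSet.{0}) : Prop :=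
  CtblIn W X ∧ ∀ n, n ∈ ZFSet.omega → ∀ f, f ∈ W → ¬ IsSurjF n X f

/-- The `ω₁` of `W`. -/
def omega1In (W : Set ZFSet.{0}) : ZFSet.{0} :=
  leastOrd (fun α => CardIn W α ∧ ZFSet.omega ∈ α)

/-- The `ω₂` of `W`. -/
def omega2In (W : Set ZFSet.{0}) : ZFSet.{0} :=
  leastOrd (fun α => CardIn W α ∧ omega1In W ∈ α)

/-- The cardinal successor of `κ` as computed in `W`. -/
def SuccCardIn (W : Set ZFSet.{0}) (κ : ZFSet.{0}) : ZFSet.{0} :=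
  leastOrd (fun α => CardIn W α ∧ κ ∈ α)

/-- `WRP^L(γ)` as computed inside the (transitive) model `W`:  for some
`κ ∈ W` regular in `W` with `γ < κ` there is an `X ∈ W`, countably infinite
in `W`, with `X ≺ H_κ^W`, `γ ∈ X`, whose collapse sends `γ` to a cardinal of
the `L` of `W`. -/
def WRPLIn (W : Set ZFSet.{0}) (γ : ZFSet.{0}) : Prop :=
  ∃ κ, κ ∈ W ∧ RegularIn W κ ∧ γ ∈ κ ∧
    ∃ X, X ∈ W ∧ ElemSub X (HsetIn W κ) ∧ CtblInfIn W X ∧ γ ∈ X ∧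
      CardIn (LClassIn W) (collapse X γ)

/-- `SRP^L(γ)` as computed inside the (transitive) model `W`. -/
def SRPLIn (W : Set ZFSet.{0}) (γ : ZFSet.{0}) : Prop :=
  ∃ κ, κ ∈ W ∧ RegularIn W κ ∧ γ ∈ κ ∧
    ∀ X, X ∈ W → ElemSub X (HsetIn W κ) → CtblInfIn W X → γ ∈ X →
      CardIn (LClassIn W) (collapse X γ)

/-! ### Models of (fragments of) ZFC, semantically -/

/-- `W` is a transitive model of `ZFC⁻` (ZFC with Power Set deleted and with
Collection), rendered semantically: nonempty, transitive, closed under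
pairing and union, contains `ω`, satisfies full Separation and Collection for
first-order formulas with parameters, and Choice. -/
def ModelsZFCminus (W : Set ZFSet.{0}) : Prop :=
  (∃ x, x ∈ W) ∧
  (∀ x, x ∈ W → x.toSet ⊆ W) ∧
  (∀ x y, x ∈ W → y ∈ W → insert x (insert y (∅ : ZFSet.{0})) ∈ W) ∧
  (∀ x, x ∈ W → ZFSet.sUnion x ∈ W) ∧
  (ZFSet.omega ∈ W) ∧
  (∀ (n : ℕ) (φ : Fml (n + 1)) (v : Fin n → ZFSet.{0}), (∀ i, v i ∈ W) → ∀ a, a ∈ W →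
    ZFSet.sep (fun z => SatAB W ∅ ∅ φ (Fin.cons z v)) a ∈ W) ∧
  (∀ (n : ℕ) (φ : Fml (n + 2)) (v : Fin n → ZFSet.{0}), (∀ i, v i ∈ W) → ∀ a, a ∈ W →
    (∀ x, x ∈ a → ∃ y, y ∈ W ∧ SatAB W ∅ ∅ φ (Fin.cons x (Fin.cons y v))) →
    ∃ b, b ∈ W ∧ ∀ x, x ∈ a → ∃ y, y ∈ b ∧ SatAB W ∅ ∅ φ (Fin.cons x (Fin.cons y v))) ∧
  (∀ x, x ∈ W → (∀ y, y ∈ x → y ≠ ∅) →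
    ∃ c, c ∈ W ∧ ∀ y, y ∈ x → ∃! z, z ∈ y ∧ ZFSet.pair y z ∈ c)

/-- `W` is a transitive model of `ZFC` (with Power Set). -/
def ModelsZFC (W : Set ZFSet.{0}) : Prop :=
  ModelsZFCminus W ∧ ∀ x, x ∈ W → ∃ p, p ∈ W ∧ ∀ z, z ∈ W → (z ∈ p ↔ z ⊆ x)

/-- `W` is a model of `Z₂ = ZFC⁻ +` "every set is countable". -/
def ModelsZ2 (W : Set ZFSet.{0}) : Prop :=
  ModelsZFCminus W ∧ ∀ x, x ∈ W → CtblIn W x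

/-- `p` is the power set of `x` as computed in `W`. -/
def IsPowIn (W : Set ZFSet.{0}) (x p : ZFSet.{0}) : Prop :=
  p ∈ W ∧ ∀ z, z ∈ W → (z ∈ p ↔ z ⊆ x)

/-- `W` is a model of `Z₃ = ZFC⁻ + 𝒫(ω)` exists `+` every set has size `≤ ℶ₁`. -/
def ModelsZ3 (W : Set ZFSet.{0}) : Prop :=
  ModelsZFCminus W ∧ (∃ p, IsPowIn W ZFSet.omega p) ∧
    ∀ x, x ∈ W → ∀ p, IsPowIn W ZFSet.omega p → ∃ f, f ∈ W ∧ IsInjF x p f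

/-- `W` is a model of `Z₄ = ZFC⁻ + 𝒫(𝒫(ω))` exists `+` every set has size `≤ ℶ₂`. -/
def ModelsZ4 (W : Set ZFSet.{0}) : Prop :=
  ModelsZFCminus W ∧
    (∃ p q, IsPowIn W ZFSet.omega p ∧ IsPowIn W p q) ∧
    ∀ x, x ∈ W → ∀ p q, IsPowIn W ZFSet.omega p → IsPowIn W p q →
      ∃ f, f ∈ W ∧ IsInjF x q f

/-! ### Forcing: the Lévy collapse, genericity, generic extensions -/

/-- The Lévy collapse `Col(ω, <κ)`: finite partial functions `p` with
`p(α, n) ∈ α` for `α < κ`, `n < ω`. -/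
def ColLt (κ : ZFSet.{0}) : ZFSet.{0} :=
  ZFSet.sep (fun p => p.toSet.Finite ∧
      (∀ z, z ∈ p → ∃ α n β, α ∈ κ ∧ n ∈ ZFSet.omega ∧ β ∈ α ∧
        z = ZFSet.pair (ZFSet.pair α n) β) ∧
      (∀ α n β β', ZFSet.pair (ZFSet.pair α n) β ∈ p →
        ZFSet.pair (ZFSet.pair α n) β' ∈ p → β = β'))
    (ZFSet.powerset (prodZ (prodZ κ ZFSet.omega) (ZFSet.sUnion κ)))

/-- `G` is a filter on the partial order `P` of partial functions ordered by
reverse inclusion (`p` is stronger than `q` iff `q ⊆ p`) which meets every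
dense subset of `P` lying in the (transitive) model `W`. -/
def GenericOver (W : Set ZFSet.{0}) (P G : ZFSet.{0}) : Prop :=
  G ⊆ P ∧
  (∀ p q, p ∈ G → q ∈ P → q ⊆ p → q ∈ G) ∧
  (∀ p q, p ∈ G → q ∈ G → ∃ r, r ∈ G ∧ p ⊆ r ∧ q ⊆ r) ∧
  (∀ D, D ∈ W → D ⊆ P → (∀ p, p ∈ P → ∃ q, q ∈ D ∧ p ⊆ q) → ∃ q, q ∈ G ∧ q ∈ D)

/-- Genericity for an abstract partial order `R` (a set of pairs) on `P`:
`pair p q ∈ R` means `p` is stronger than (extends) `q`. -/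
def GenericOnP (W : Set ZFSet.{0}) (P R G : ZFSet.{0}) : Prop :=
  G ⊆ P ∧
  (∀ p q, p ∈ G → q ∈ P → ZFSet.pair p q ∈ R → q ∈ G) ∧
  (∀ p q, p ∈ G → q ∈ G → ∃ r, r ∈ G ∧ ZFSet.pair r p ∈ R ∧ ZFSet.pair r q ∈ R) ∧
  (∀ D, D ∈ W → D ⊆ P → (∀ p, p ∈ P → ∃ q, q ∈ D ∧ ZFSet.pair q p ∈ R) →
    ∃ q, q ∈ G ∧ q ∈ D)

/-- Evaluation of a forcing name `τ` by a filter `G`: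
`nameVal G τ = {nameVal G σ | ∃ p ∈ G, (σ, p) ∈ τ}`. -/
def nameVal (G : ZFSet.{0}) : ZFSet.{0} → ZFSet.{0} :=
  (ZFSet.mem_wf.transGen).fix (C := fun _ => ZFSet.{0}) fun τ ih =>
    img (fun σ => if h : Relation.TransGen (· ∈ ·) σ τ then ih σ h else ∅)
      (ZFSet.sep (fun σ => ∃ p, p ∈ G ∧ ZFSet.pair σ p ∈ τ)
        (ZFSet.sUnion (ZFSet.sUnion τ)))

/-- The generic extension `M[G]` of a transitive set model `M`, via names. -/
def extSet (M G : ZFSet.{0}) : Set ZFSet.{0} := {x | ∃ τ, τ ∈ M ∧ x = nameVal G τ}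

/-! ### Remarkable cardinals (Schindler), relative to a ground model class -/

/-- Clubs of countable subsets of `S`, as computed in the (transitive) model
`E`: the club is coded by a set `D ∈ E`, its members are subsets of `S`
countably infinite in `E`, it is cofinal among such sets lying in `E`, and it
is closed under unions of increasing `ω`-chains coded in `E`. -/
def ClubSubIn (E : Set ZFSet.{0}) (S : Set ZFSet.{0}) (D : ZFSet.{0}) : Prop :=
  D ∈ E ∧
  (∀ X, X ∈ D → X.toSet ⊆ S ∧ CtblInfIn E X) ∧
  (∀ X : ZFSet.{0}, X ∈ E → X.toSet ⊆ S → CtblInfIn E X → ∃ Y, Y ∈ D ∧ X ⊆ Y) ∧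
  (∀ g, g ∈ E → ZFSet.IsFunc ZFSet.omega D g →
    (∀ n y y', n ∈ ZFSet.omega → ZFSet.pair n y ∈ g →
      ZFSet.pair (insert n n) y' ∈ g → y ⊆ y') →
    ZFSet.sUnion (imageOf g) ∈ D)

/-- Stationarity of a collection `C` of countable subsets of `S`, as computed
in the model `E`. -/
def StatSubIn (E : Set ZFSet.{0}) (S : Set ZFSet.{0}) (C : Set ZFSet.{0}) : Prop :=
  ∀ D : ZFSet.{0}, ClubSubIn E S D → ∃ X, X ∈ C ∧ X ∈ D

/-- `X` condenses remarkably (with ground model `W`, extension operation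
`Ext` sending a generic object to the corresponding extension of `W`,
collapse height `δ`, target `θ`, and generic `G`):  `X = ran(π)` for some
elementary `π : (H_β^{W[G∩H_α^W]}, ∈, H_β^W, G∩H_α^W) → (H_θ^{W[G]}, ∈, H_θ^W, G)`
with `α = crit(π) < β < δ` and `β` a cardinal of `W`. -/
def CondensesRemarkably (W : Set ZFSet.{0}) (Ext : ZFSet.{0} → Set ZFSet.{0})
    (δ θ G X : ZFSet.{0}) : Prop :=
  ∃ (f : ZFSet.{0} → ZFSet.{0}) (α β : ZFSet.{0}), IsOrd α ∧ α ∈ β ∧ β ∈ δ ∧ CardIn W β ∧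
    (∀ ξ, ξ ∈ α → f ξ = ξ) ∧ f α ≠ α ∧
    (let Gα : ZFSet.{0} := ZFSet.sep (fun p => p ∈ HsetIn W α) G
     let Dom : Set ZFSet.{0} := HsetIn (Ext Gα) β
     let Cod : Set ZFSet.{0} := HsetIn (Ext G) θ
     Set.MapsTo f Dom Cod ∧ X.toSet = f '' Dom ∧
     ∀ (n : ℕ) (φ : Fml n) (v : Fin n → ZFSet.{0}), (∀ i, v i ∈ Dom) →
       (SatAB Dom W Gα.toSet φ v ↔ SatAB Cod W G.toSet φ (f ∘ v)))

/-- `δ` is `θ`-remarkable, in the sense of the (transitive) ground model `W`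
with extensions given by `Ext`: for every `G` which is `Col(ω, <δ)`-generic
over `W`, in `W[G]` the set of countable `X ⊆ H_θ^{W[G]}` which condense
remarkably is stationary. -/
def ThetaRemarkableVia (W : Set ZFSet.{0}) (Ext : ZFSet.{0} → Set ZFSet.{0})
    (δ θ : ZFSet.{0}) : Prop :=
  ∀ G, GenericOver W (ColLt δ) G →
    StatSubIn (Ext G) (HsetIn (Ext G) θ)
      {X | CondensesRemarkably W Ext δ θ G X}

/-- `δ` is remarkable in the sense of `(W, Ext)`:  `θ`-remarkable for every
regular (in `W`) `θ > δ`. -/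
def RemarkableVia (W : Set ZFSet.{0}) (Ext : ZFSet.{0} → Set ZFSet.{0}) (δ : ZFSet.{0}) : Prop :=
  ∀ θ, RegularIn W θ → δ ∈ θ → ThetaRemarkableVia W Ext δ θ

/-! ### Indiscernibles and sharps -/

/-- `I` is a set (or class) of ordinal indiscernibles for the structure
`(S, ∈, A)`. -/
def IndiscFor (S A : Set ZFSet.{0}) (I : Set ZFSet.{0}) : Prop :=
  (∀ x ∈ I, IsOrd x ∧ x ∈ S) ∧
  ∀ (n : ℕ) (φ : Fml n) (v w : Fin n → ZFSet.{0}),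
    (∀ i, v i ∈ I) → (∀ i, w i ∈ I) →
    (∀ i j : Fin n, i < j → v i ∈ v j) → (∀ i j : Fin n, i < j → w i ∈ w j) →
    (SatAB S A ∅ φ v ↔ SatAB S A ∅ φ w)

/-- `0♯` exists: for some uncountable limit ordinal `λ`, `L_λ` has an
uncountable set of indiscernibles. -/
def ZeroSharpExists : Prop :=
  ∃ lam : ZFSet.{0}, IsLimitOrd lam ∧ ¬ lam.toSet.Countable ∧
    ∃ I : ZFSet.{0}, ¬ I.toSet.Countable ∧ IndiscFor (Lstage lam).toSet ∅ I.toSet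

/-- The sharp of `L[A]` exists: for some uncountable limit ordinal `λ`, the
structure `(L_λ[A], ∈, A)` has an uncountable set of indiscernibles. -/
def SharpOverExists (A : ZFSet.{0}) : Prop :=
  ∃ lam : ZFSet.{0}, IsLimitOrd lam ∧ ¬ lam.toSet.Countable ∧
    ∃ I : ZFSet.{0}, ¬ I.toSet.Countable ∧
      IndiscFor (LstageA A.toSet lam).toSet A.toSet I.toSet

/-- `I` is a closed unbounded proper class of ordinals. -/
def ProperClassClub (I : Set ZFSet.{0}) : Prop :=
  (∀ x ∈ I, IsOrd x) ∧
  (∀ α, IsOrd α → ∃ β, IsOrd β ∧ α ∈ β ∧ β ∈ I) ∧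
  (∀ α, IsOrd α → α ≠ ∅ → (∀ β ∈ α, ∃ θ, θ ∈ I ∧ θ ∈ α ∧ (β ∈ θ ∨ β = θ)) → α ∈ I)

/-- `s` is (a real coding) `0♯`: there is a closed unbounded proper class `I`
of Silver indiscernibles for `L` and `s` is the set of codes of formulas
satisfied in `L` by increasing tuples from `I`. -/
def IsZeroSharpReal (s : ZFSet.{0}) : Prop :=
  s ⊆ ZFSet.omega ∧
  ∃ I : Set ZFSet.{0}, ProperClassClub I ∧ IndiscFor LClass ∅ I ∧
    s = ZFSet.sep (fun m => ∃ (n : ℕ) (φ : Fml n) (v : Fin n → ZFSet.{0}),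
          (∀ i, v i ∈ I) ∧ (∀ i j : Fin n, i < j → v i ∈ v j) ∧
          Sat LClass φ v ∧ m = natZ (Nat.pair n (codeF φ))) ZFSet.omega

/-! ### Admissible ordinals and Harrington's Principle -/

/-- The (graph of the) function `f` is `Σ₁`-definable with parameters over the
structure `(S, ∈)`. -/
def Sigma1DefOver (S : Set ZFSet.{0}) (f : ZFSet.{0} → ZFSet.{0}) : Prop :=
  ∃ (n : ℕ) (ψ : Fml (n + 3)), IsDelta0 ψ ∧
    ∃ p : Fin n → ZFSet.{0}, (∀ i, p i ∈ S) ∧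
      ∀ a b, a ∈ S → b ∈ S →
        (f a = b ↔ Sat S (Fml.ex ψ) (Fin.cons a (Fin.cons b p)))

/-- `α` is `x`-admissible: `α > ω` is a limit ordinal and no
`Σ₁(L_α[x])`-definable function maps some `δ < α` cofinally into `α`. -/
def Admissible (x α : ZFSet.{0}) : Prop :=
  IsLimitOrd α ∧ ZFSet.omega ∈ α ∧
  ¬ ∃ δ, δ ∈ α ∧ ∃ f : ZFSet.{0} → ZFSet.{0},
      Sigma1DefOver (LstageA x.toSet α).toSet f ∧
      (∀ β, β ∈ δ → f β ∈ α) ∧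
      ∀ ξ, ξ ∈ α → ∃ β, β ∈ δ ∧ (ξ ∈ f β ∨ ξ = f β)

/-- The generalized Harrington Principle `HP(M)` for the inner model given by
the class `W`: there is a real `x` such that every `x`-admissible ordinal is a
cardinal of `W`. -/
def HPclass (W : Set ZFSet.{0}) : Prop :=
  ∃ x : ZFSet.{0}, x ⊆ ZFSet.omega ∧ ∀ α, Admissible x α → CardIn W α

/-- Harrington's Principle `HP(L)`. -/
def HPL : Prop := HPclass LClass

/-- `HP(L)` as computed inside the (transitive) model `W`. -/
def HPLIn (W : Set ZFSet.{0}) : Prop :=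
  ∃ x, x ∈ W ∧ x ⊆ ZFSet.omega ∧
    ∀ α, α ∈ W → Admissible x α → CardIn (LClassIn W) α

/-! ### Inner models, elementary embeddings, rigidity, covering -/

/-- `W` is an inner model: a transitive proper class containing all ordinals
and satisfying ZFC. -/
def InnerModelClass (W : Set ZFSet.{0}) : Prop :=
  (∀ x, x ∈ W → x.toSet ⊆ W) ∧ (∀ α : ZFSet.{0}, IsOrd α → α ∈ W) ∧ ModelsZFC W

/-- `j` is an elementary embedding of the class `(W, ∈)` into itself. -/
def ElemEmbOn (W : Set ZFSet.{0}) (j : ZFSet.{0} → ZFSet.{0}) : Prop :=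
  Set.MapsTo j W W ∧
  ∀ (n : ℕ) (φ : Fml n) (v : Fin n → ZFSet.{0}),
    (∀ i, v i ∈ W) → (Sat W φ v ↔ Sat W φ (j ∘ v))

/-- `W` has the rigidity property: there is no nontrivial elementary embedding
from `W` to `W`. -/
def RigidClass (W : Set ZFSet.{0}) : Prop :=
  ¬ ∃ j : ZFSet.{0} → ZFSet.{0}, ElemEmbOn W j ∧ ∃ x, x ∈ W ∧ j x ≠ x

/-- `W` has the full covering property: every set `X` of ordinals is covered
by some `Y ∈ W` with `|Y| = |X| + ω₁`. -/
def FullCovering (W : Set ZFSet.{0}) : Prop :=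
  ∀ X : ZFSet.{0}, (∀ z ∈ X, IsOrd z) →
    ∃ Y, Y ∈ W ∧ X ⊆ Y ∧ Nonempty (Y.toSet ≃ (X.toSet ⊕ (Aleph 1).toSet))

/-- The restriction `M|θ` of the inner model `W`: its elements of rank `< θ`. -/
def restrictTo (W : Set ZFSet.{0}) (θ : ZFSet.{0}) : Set ZFSet.{0} :=
  {x | x ∈ W ∧ rankZ x ∈ θ}

/-- The class `S` is definable (with parameters) in `H_θ`. -/
def DefinableInH (θ : ZFSet.{0}) (S : Set ZFSet.{0}) : Prop :=
  ∃ (n : ℕ) (φ : Fml (n + 1)) (v : Fin n → ZFSet.{0}),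
    (∀ i, v i ∈ Hset θ) ∧ ∀ x, x ∈ Hset θ → (x ∈ S ↔ Sat (Hset θ) φ (Fin.cons x v))

/-- `ν` is weakly inaccessible in `W`: a regular limit cardinal of `W`. -/
def WeaklyInaccIn (W : Set ZFSet.{0}) (ν : ZFSet.{0}) : Prop :=
  RegularIn W ν ∧ ZFSet.omega ∈ ν ∧
    ∀ β, β ∈ ν → ∃ δ, δ ∈ ν ∧ β ∈ δ ∧ CardIn W δ

/-! ### Measures, `κ`-models and `0†` -/

/-- `⟨L[U], ∈, U⟩ ⊨ "U is a normal ultrafilter over κ"`:  `L[U]` is a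
`κ`-model. -/
def IsKappaModel (κ U : ZFSet.{0}) : Prop :=
  IsOrd κ ∧ ZFSet.omega ∈ κ ∧ U ∈ LrelClass U ∧
  (∀ X, X ∈ U → X ⊆ κ ∧ X ∈ LrelClass U) ∧ κ ∈ U ∧ (∅ : ZFSet.{0}) ∉ U ∧
  (∀ X Y, X ∈ U → Y ∈ U → X ∩ Y ∈ U) ∧
  (∀ X Y, X ∈ U → Y ∈ LrelClass U → X ⊆ Y → Y ⊆ κ → Y ∈ U) ∧
  (∀ X, X ∈ LrelClass U → X ⊆ κ → (X ∈ U ∨ κ \ X ∈ U)) ∧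
  (∀ α, α ∈ κ → (insert α ∅ : ZFSet.{0}) ∉ U) ∧
  (∀ δ g, δ ∈ κ → g ∈ LrelClass U → ZFSet.IsFunc δ (ZFSet.powerset κ) g →
    (∀ ξ y, ZFSet.pair ξ y ∈ g → y ∈ U) →
    ZFSet.sep (fun β => ∀ ξ, ξ ∈ δ → ∀ y, ZFSet.pair ξ y ∈ g → β ∈ y) κ ∈ U) ∧
  (∀ f X, f ∈ LrelClass U → X ∈ U → ZFSet.IsFunc κ κ f →
    (∀ α, α ∈ X → α ≠ ∅ → ∀ y, ZFSet.pair α y ∈ f → y ∈ α) →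
    ∃ β Y, β ∈ κ ∧ Y ∈ U ∧ ∀ α, α ∈ Y → ZFSet.pair α β ∈ f)

/-- `0†` exists: there is a `κ`-model (for some `κ`) and a nontrivial
elementary embedding from that model to itself with critical point
greater than `κ`. -/
def ZeroDaggerExists : Prop :=
  ∃ κ U : ZFSet.{0}, IsKappaModel κ U ∧
    ∃ j : ZFSet.{0} → ZFSet.{0}, ElemEmbOn (LrelClass U) j ∧
      ∃ η, IsOrd η ∧ κ ∈ η ∧ (∀ β, β ∈ η → j β = β) ∧ j η ≠ η

/-- `U` witnesses that `κ` is a measurable cardinal (in `V`): `U` is a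
`κ`-complete nonprincipal normal ultrafilter on `κ`. -/
def IsMeasureOn (κ U : ZFSet.{0}) : Prop :=
  IsOrd κ ∧ ZFSet.omega ∈ κ ∧
  (∀ X, X ∈ U → X ⊆ κ) ∧ κ ∈ U ∧ (∅ : ZFSet.{0}) ∉ U ∧
  (∀ X Y, X ∈ U → Y ∈ U → X ∩ Y ∈ U) ∧
  (∀ X Y, X ∈ U → X ⊆ Y → Y ⊆ κ → Y ∈ U) ∧
  (∀ X : ZFSet.{0}, X ⊆ κ → (X ∈ U ∨ κ \ X ∈ U)) ∧
  (∀ α, α ∈ κ → (insert α ∅ : ZFSet.{0}) ∉ U) ∧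
  (∀ x : ZFSet.{0}, x.toSet ⊆ U.toSet → CardLT x κ → x ≠ ∅ →
    ZFSet.sep (fun β => ∀ y, y ∈ x → β ∈ y) κ ∈ U) ∧
  (∀ f X, X ∈ U → ZFSet.IsFunc κ κ f →
    (∀ α, α ∈ X → α ≠ ∅ → ∀ y, ZFSet.pair α y ∈ f → y ∈ α) →
    ∃ β Y, β ∈ κ ∧ Y ∈ U ∧ ∀ α, α ∈ Y → ZFSet.pair α β ∈ f)

/-- `κ` is a measurable cardinal. -/
def IsMeasurable (κ : ZFSet.{0}) : Prop := ∃ U, IsMeasureOn κ U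

/-- `U ∈ W` witnesses measurability of `κ` inside the inner model `W`. -/
def MeasurableIn (W : Set ZFSet.{0}) (κ U : ZFSet.{0}) : Prop :=
  U ∈ W ∧ IsOrd κ ∧ ZFSet.omega ∈ κ ∧
  (∀ X, X ∈ U → X ⊆ κ) ∧ κ ∈ U ∧ (∅ : ZFSet.{0}) ∉ U ∧
  (∀ X Y, X ∈ U → Y ∈ U → X ∩ Y ∈ U) ∧
  (∀ X Y, X ∈ U → Y ∈ W → X ⊆ Y → Y ⊆ κ → Y ∈ U) ∧
  (∀ X, X ∈ W → X ⊆ κ → (X ∈ U ∨ κ \ X ∈ U)) ∧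
  (∀ α, α ∈ κ → (insert α ∅ : ZFSet.{0}) ∉ U) ∧
  (∀ δ g, δ ∈ κ → g ∈ W → ZFSet.IsFunc δ (ZFSet.powerset κ) g →
    (∀ ξ y, ZFSet.pair ξ y ∈ g → y ∈ U) →
    ZFSet.sep (fun β => ∀ ξ, ξ ∈ δ → ∀ y, ZFSet.pair ξ y ∈ g → β ∈ y) κ ∈ U)

/-- There is an inner model with a measurable cardinal. -/
def ExistsInnerModelMeasurable : Prop :=
  ∃ W : Set ZFSet.{0}, InnerModelClass W ∧ ∃ κ U, MeasurableIn W κ U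

/-! ### Core-model-like inner models -/

/-- `W` satisfies the GCH. -/
def GCHIn (W : Set ZFSet.{0}) : Prop :=
  ∀ κ, CardIn W κ → (ZFSet.omega ∈ κ ∨ ZFSet.omega = κ) →
    ∃ f, f ∈ W ∧ IsInjF (ZFSet.sep (fun z => z ∈ W) (ZFSet.powerset κ))
      (SuccCardIn W κ) f

/-- `W` has the condensation property: the transitive collapse of any
elementary submodel of an initial segment of `W` is again an initial segment
of `W`. -/
def CondensationFor (W : Set ZFSet.{0}) : Prop :=
  ∀ θ : ZFSet.{0}, IsOrd θ → ∀ X : ZFSet.{0},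
    X.toSet ⊆ restrictTo W θ → ElemSub X (restrictTo W θ) →
    ∃ θ', IsOrd θ' ∧ (collapseSet X).toSet = restrictTo W θ'

/-- The properties of the Dodd–Jensen core model `K` (below a measurable
cardinal) which are relevant here: `K` is an inner model satisfying the GCH,
with condensation, and (by Dodd–Jensen, given that there is no inner model
with a measurable) the rigidity property. -/
def CoreModelProps (W : Set ZFSet.{0}) : Prop :=
  InnerModelClass W ∧ GCHIn W ∧ CondensationFor W ∧ RigidClass W

/-! ### `L(ℝ)`, determinacy, and `HOD` -/

/-- The base of the `L(ℝ)` hierarchy: the transitive closure of `{𝒫(ω)}`. -/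
def lrBase : ZFSet.{0} :=
  insert (ZFSet.powerset ZFSet.omega) (tcl (ZFSet.powerset ZFSet.omega))

/-- The hierarchy `L_α(ℝ)`. -/
def LRstage : ZFSet.{0} → ZFSet.{0} :=
  ZFSet.mem_wf.fix (C := fun _ => ZFSet.{0}) fun α ih =>
    lrBase ∪ ZFSet.sUnion
      (img (fun β => if h : β ∈ α then DefSetA ∅ (ih β h) else ∅) α)

/-- The class `L(ℝ)`. -/
def LRClass : Set ZFSet.{0} := {x | ∃ α, IsOrd α ∧ x ∈ LRstage α}

/-- The `ZFSet` coding the function `ω → ω` given by `g`. -/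
def seqCode (g : ℕ → ℕ) : ZFSet.{0} :=
  img (fun m => ZFSet.pair m (natZ (g (zfToNat m)))) ZFSet.omega

/-- The game on `ω` with payoff `A` (a set of coded functions `ω → ω`) is
determined: one of the two players has a winning strategy. -/
def DeterminedZ (A : ZFSet.{0}) : Prop :=
  (∃ σ : List ℕ → ℕ, ∀ g : ℕ → ℕ,
    (∀ n : ℕ, g (2 * n) = σ (List.ofFn (fun i : Fin (2 * n) => g i.val))) →
    seqCode g ∈ A) ∨
  (∃ τ : List ℕ → ℕ, ∀ g : ℕ → ℕ,
    (∀ n : ℕ, g (2 * n + 1) = τ (List.ofFn (fun i : Fin (2 * n + 1) => g i.val))) →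
    seqCode g ∉ A)

/-- `AD^{L(ℝ)}`: every set of reals in `L(ℝ)` is determined.  (Since every
real, and every strategy, belongs to `L(ℝ)`, this is equivalent to `L(ℝ) ⊨ AD`.) -/
def ADinLR : Prop :=
  ∀ A, A ∈ LRClass → (∀ f, f ∈ A → ZFSet.IsFunc ZFSet.omega ZFSet.omega f) →
    DeterminedZ A

/-- `x` is ordinal definable. -/
def IsOD (x : ZFSet.{0}) : Prop :=
  ∃ (n : ℕ) (φ : Fml (n + 1)) (v : Fin n → ZFSet.{0}),
    (∀ i, IsOrd (v i)) ∧ ∀ y, (Sat Set.univ φ (Fin.cons y v) ↔ y = x)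

/-- The class `HOD` of hereditarily ordinal definable sets. -/
def HODClass : Set ZFSet.{0} :=
  {x | IsOD x ∧ ∀ y, y ∈ tcl x → IsOD y}

/-- The class `L[A]` as computed inside the (transitive) model `W`. -/
def LrelClassIn (W : Set ZFSet.{0}) (A : ZFSet.{0}) : Set ZFSet.{0} :=
  {x | ∃ α, IsOrd α ∧ α ∈ W ∧ x ∈ LstageA A.toSet α}

/-! ## The statement -/

open Cardinal

/-! ### Unfolding lemmas -/

theorem mem_toSet {x y : ZFSet.{0}} : x ∈ y.toSet ↔ x ∈ y := Iff.rfl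

theorem mem_img {f : ZFSet.{0} → ZFSet.{0}} {x y : ZFSet.{0}} :
    y ∈ img f x ↔ ∃ z ∈ x, f z = y :=
  @ZFSet.mem_image f (Classical.allZFSetDefinable _) x y

theorem mem_collapse {X y w : ZFSet.{0}} :
    w ∈ collapse X y ↔ ∃ z ∈ y, z ∈ X ∧ w = collapse X z := by
  unfold collapse
  rw [WellFounded.fix_eq, mem_img]
  constructor
  · rintro ⟨z, hz, h⟩
    obtain ⟨h1, h2⟩ := ZFSet.mem_sep.1 hz
    rw [dif_pos h1] at h
    exact ⟨z, h1, h2, h.symm⟩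
  · rintro ⟨z, h1, h2, h⟩
    refine ⟨z, ZFSet.mem_sep.2 ⟨h1, h2⟩, ?_⟩
    rw [dif_pos h1, h]

/-- The definable power set. -/
def Dset (X : ZFSet.{0}) : ZFSet.{0} := DefSetA ∅ X

theorem mem_Dset {X B : ZFSet.{0}} : B ∈ Dset X ↔
    ∃ (n : ℕ) (φ : Fml (n + 1)) (v : Fin n → ZFSet.{0}),
      (∀ i, v i ∈ X) ∧ B = ZFSet.sep (fun z => Sat X.toSet φ (Fin.cons z v)) X := by
  unfold Dset DefSetA Sat
  rw [ZFSet.mem_sep, ZFSet.mem_powerset]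
  constructor
  · exact fun h => h.2
  · rintro ⟨n, φ, v, h1, h2⟩
    exact ⟨h2 ▸ ZFSet.sep_subset, n, φ, v, h1, h2⟩

theorem subset_of_mem_Dset {X B : ZFSet.{0}} (h : B ∈ Dset X) : B ⊆ X := by
  obtain ⟨n, φ, v, -, rfl⟩ := mem_Dset.1 h
  exact ZFSet.sep_subset

theorem mem_Lstage {α B : ZFSet.{0}} :
    B ∈ Lstage α ↔ ∃ β ∈ α, B ∈ Dset (Lstage β) := by
  unfold Lstage LstageA Dset
  rw [WellFounded.fix_eq, ZFSet.mem_sUnion]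
  constructor
  · rintro ⟨z, hz, hB⟩
    obtain ⟨β, h1, h2⟩ := mem_img.1 hz
    rw [dif_pos h1] at h2
    exact ⟨β, h1, h2 ▸ hB⟩
  · rintro ⟨β, h1, hB⟩
    refine ⟨_, mem_img.2 ⟨β, h1, rfl⟩, ?_⟩
    rw [dif_pos h1]
    exact hB

theorem IsOrd.mem {α β : ZFSet.{0}} (h : IsOrd α) (hb : β ∈ α) : IsOrd β :=
  ⟨h.2 β hb, fun y hy => h.2 y (h.1 β hb hy)⟩

theorem IsOrd.trans {α β δ : ZFSet.{0}} (h : IsOrd α) (hb : β ∈ α) (hd : δ ∈ β) : δ ∈ α :=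
  h.1 β hb hd

theorem isOrd_iff {x : ZFSet.{0}} : IsOrd x ↔ x.IsOrdinal :=
  ZFSet.isOrdinal_iff_forall_mem_isTransitive.symm

theorem isOrd_collapse {X γ : ZFSet.{0}} (h : IsOrd γ) : IsOrd (collapse X γ) := by
  have key : ∀ β : ZFSet.{0}, β.IsTransitive → (collapse X β).IsTransitive := by
    intro β hβ y hy w hw
    obtain ⟨z, hz, -, rfl⟩ := mem_collapse.1 hy
    obtain ⟨z', hz', hX, rfl⟩ := mem_collapse.1 hw
    exact mem_collapse.2 ⟨z', hβ z hz hz', hX, rfl⟩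
  refine ⟨key γ h.1, fun y hy => ?_⟩
  obtain ⟨z, hz, -, rfl⟩ := mem_collapse.1 hy
  exact key z (h.2 z hz)

/-- On a transitive set the collapse by `X` only depends on the trace of `X`. -/
theorem collapse_congr {X Y : ZFSet.{0}} (t : ZFSet.{0}) (ht : t.IsTransitive)
    (h : ∀ z ∈ t, z ∈ X ↔ z ∈ Y) : collapse X t = collapse Y t := by
  have key : ∀ y : ZFSet.{0}, y ⊆ t → collapse X y = collapse Y y := by
    intro y
    induction y using ZFSet.inductionOn with
    | _ y ih =>
      intro hy
      ext w
      rw [mem_collapse, mem_collapse]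
      constructor
      · rintro ⟨z, hz, hX, rfl⟩
        exact ⟨z, hz, (h z (hy hz)).1 hX, ih z hz (ht z (hy hz))⟩
      · rintro ⟨z, hz, hX, rfl⟩
        exact ⟨z, hz, (h z (hy hz)).2 hX, (ih z hz (ht z (hy hz))).symm⟩
  exact key t fun _ h => h

/-- The collapse is the identity on transitive subsets. -/
theorem collapse_eq_self {X : ZFSet.{0}} : ∀ y : ZFSet.{0}, y.IsTransitive → y ⊆ X →
    collapse X y = y := by
  have key : ∀ t : ZFSet.{0}, t.IsTransitive → t ⊆ X → ∀ y : ZFSet.{0}, y ⊆ t →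
      collapse X y = y := by
    intro t ht hX y
    induction y using ZFSet.inductionOn with
    | _ y ih =>
      intro hy
      ext w
      rw [mem_collapse]
      constructor
      · rintro ⟨z, hz, -, rfl⟩
        rwa [ih z hz (ht z (hy hz))]
      · intro hw
        exact ⟨w, hw, hX (hy hw), (ih w hw (ht w (hy hw))).symm⟩
  exact fun y hy hX => key y hy hX y fun _ h => h

/-! ### Formulas -/

/-- Lifting a renaming of variables under a quantifier. -/
def liftRen {n m : ℕ} (σ : Fin n → Fin m) : Fin (n + 1) → Fin (m + 1) :=
  Fin.cons 0 fun i => (σ i).succ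

/-- Renaming the free variables of a formula. -/
def ren : ∀ {n m : ℕ}, (Fin n → Fin m) → Fml n → Fml m
  | _, _, σ, .mem i j => .mem (σ i) (σ j)
  | _, _, σ, .eq i j => .eq (σ i) (σ j)
  | _, _, σ, .inA i => .inA (σ i)
  | _, _, σ, .inB i => .inB (σ i)
  | _, _, σ, .not φ => .not (ren σ φ)
  | _, _, σ, .and φ ψ => .and (ren σ φ) (ren σ ψ)
  | _, _, σ, .ex φ => .ex (ren (liftRen σ) φ)

theorem sat_ren (S : Set ZFSet.{0}) {n m : ℕ} (σ : Fin n → Fin m) (φ : Fml n)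
    (v : Fin m → ZFSet.{0}) : Sat S (ren σ φ) v ↔ Sat S φ (fun i => v (σ i)) := by
  induction φ generalizing m with
  | mem | eq | inA | inB => simp [ren, Sat, SatAB]
  | not φ ih => simpa [ren, Sat, SatAB] using not_congr (ih σ v)
  | and φ ψ ih1 ih2 => simpa [ren, Sat, SatAB] using and_congr (ih1 σ v) (ih2 σ v)
  | ex φ ih =>
    have hcons : ∀ x : ZFSet.{0}, (fun i => (Fin.cons x v : Fin _ → ZFSet.{0}) (liftRen σ i)) =
        Fin.cons x fun i => v (σ i) := by
      intro x
      funext i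
      refine Fin.cases ?_ (fun j => ?_) i <;> simp [liftRen]
    simp only [ren, Sat, SatAB]
    refine exists_congr fun x => and_congr_right fun _ => ?_
    have := ih (liftRen σ) (Fin.cons x v)
    rwa [hcons x] at this

theorem codeF_injective : ∀ {n : ℕ} (φ ψ : Fml n), codeF φ = codeF ψ → φ = ψ
  | _, .mem i j, ψ, h => by cases ψ <;> simp_all [codeF, Fin.ext_iff]
  | _, .eq i j, ψ, h => by cases ψ <;> simp_all [codeF, Fin.ext_iff]
  | _, .inA i, ψ, h => by cases ψ <;> simp_all [codeF, Fin.ext_iff]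
  | _, .inB i, ψ, h => by cases ψ <;> simp_all [codeF, Fin.ext_iff]
  | _, .not φ, .not ψ, h => by
    rw [codeF_injective φ ψ (by simpa [codeF] using h)]
  | _, .and φ φ', .and ψ ψ', h => by
    have h' : codeF φ = codeF ψ ∧ codeF φ' = codeF ψ' := by simpa [codeF] using h
    rw [codeF_injective φ ψ h'.1, codeF_injective φ' ψ' h'.2]
  | _, .ex φ, .ex ψ, h => by
    rw [codeF_injective φ ψ (by simpa [codeF] using h)]
  | _, .not φ, .mem _ _, h | _, .not φ, .eq _ _, h | _, .not φ, .inA _, h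
  | _, .not φ, .inB _, h | _, .not φ, .and _ _, h | _, .not φ, .ex _, h => by
    simp [codeF] at h
  | _, .and φ _, .mem _ _, h | _, .and φ _, .eq _ _, h | _, .and φ _, .inA _, h
  | _, .and φ _, .inB _, h | _, .and φ _, .not _, h | _, .and φ _, .ex _, h => by
    simp [codeF] at h
  | _, .ex φ, .mem _ _, h | _, .ex φ, .eq _ _, h | _, .ex φ, .inA _, h
  | _, .ex φ, .inB _, h | _, .ex φ, .not _, h | _, .ex φ, .and _ _, h => by
    simp [codeF] at h

instance countable_fml (n : ℕ) : Countable (Fml n) :=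
  ⟨⟨codeF, fun φ ψ => codeF_injective φ ψ⟩⟩

/-! ### Sets of hereditarily bounded cardinality -/

/-- The sets of hereditary cardinality at most `|μ|`. -/
def HC (μ : ZFSet.{0}) : Set ZFSet.{0} :=
  {x | ∃ t : ZFSet.{0}, t.IsTransitive ∧ x ∈ t ∧ #t.toSet ≤ #μ.toSet}

theorem exists_toSet_eq {X : Set ZFSet.{0}} {μ : ZFSet.{0}} (h : #X ≤ #μ.toSet) :
    ∃ z : ZFSet.{0}, z.toSet = X := by
  obtain ⟨f⟩ := h
  have : Small.{0} μ.toSet := ZFSet.small_coe μ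
  have : Small.{0} X := small_of_injective f.injective
  refine ⟨ZFSet.range fun i : X => (i : ZFSet.{0}), ?_⟩
  ext w
  rw [mem_toSet, ZFSet.mem_range]
  exact ⟨fun ⟨i, hi⟩ => hi ▸ i.2, fun hw => ⟨⟨w, hw⟩, rfl⟩⟩

theorem HC.trans {μ x y : ZFSet.{0}} (hx : x ∈ HC μ) (hy : y ∈ x) : y ∈ HC μ := by
  obtain ⟨t, h1, h2, h3⟩ := hx
  exact ⟨t, h1, h1 x h2 hy, h3⟩

theorem HC.of_subset {μ x : ZFSet.{0}} (hμ : ℵ₀ ≤ #μ.toSet) (hx : x.toSet ⊆ HC μ)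
    (hc : #x.toSet ≤ #μ.toSet) : x ∈ HC μ := by
  have hx' : ∀ y, y ∈ x.toSet → ∃ t : ZFSet.{0}, t.IsTransitive ∧ y ∈ t ∧ #t.toSet ≤ #μ.toSet :=
    fun y hy => hx hy
  choose! t ht using hx'
  have hT : #(insert x (⋃ y ∈ x.toSet, (t y).toSet) : Set ZFSet.{0}) ≤ #μ.toSet := by
    refine mk_insert_le.trans (add_le_of_le hμ ?_ (one_le_aleph0.trans hμ))
    refine (mk_biUnion_le _ _).trans ?_
    have hs : ⨆ y : x.toSet, #(t y.1).toSet ≤ #μ.toSet := ciSup_le' fun y => (ht y.1 y.2).2.2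
    refine (mul_le_mul' hc hs).trans ?_
    rw [mul_eq_self hμ]
  obtain ⟨T, hTe⟩ := exists_toSet_eq hT
  have hm : ∀ w, w ∈ T ↔ w = x ∨ ∃ y ∈ x, w ∈ t y := by
    intro w
    rw [← mem_toSet, hTe]
    simp [mem_toSet]
  refine ⟨T, ?_, (hm x).2 (Or.inl rfl), hTe ▸ hT⟩
  intro y hy z hz
  rw [hm]
  rcases (hm y).1 hy with rfl | ⟨y', hy', h⟩
  · exact Or.inr ⟨z, hz, (ht z hz).2.1⟩
  · exact Or.inr ⟨y', hy', (ht y' hy').1 y h hz⟩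

theorem HC.of_set {μ : ZFSet.{0}} (hμ : ℵ₀ ≤ #μ.toSet) {X : Set ZFSet.{0}} (hX : X ⊆ HC μ)
    (hc : #X ≤ #μ.toSet) : ∃ z ∈ HC μ, ∀ w, w ∈ z ↔ w ∈ X := by
  obtain ⟨z, rfl⟩ := exists_toSet_eq hc
  exact ⟨z, HC.of_subset hμ hX hc, fun w => Iff.rfl⟩

theorem HC.subset_mem {μ x y : ZFSet.{0}} (hμ : ℵ₀ ≤ #μ.toSet) (hx : x ∈ HC μ) (hy : y ⊆ x) :
    y ∈ HC μ := by
  obtain ⟨t, h1, h2, h3⟩ := hx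
  refine HC.of_subset hμ (fun z hz => ⟨t, h1, h1 x h2 (hy hz), h3⟩) (le_trans ?_ h3)
  exact mk_le_mk_of_subset fun z hz => h1 x h2 (hy hz)

theorem HC.card_le {μ x : ZFSet.{0}} (hx : x ∈ HC μ) : #x.toSet ≤ #μ.toSet := by
  obtain ⟨t, h1, h2, h3⟩ := hx
  exact (mk_le_mk_of_subset fun z hz => h1 x h2 hz).trans h3

theorem HC.of_transitive {μ x : ZFSet.{0}} (hμ : ℵ₀ ≤ #μ.toSet) (hx : x.IsTransitive)
    (hc : #x.toSet ≤ #μ.toSet) : x ∈ HC μ :=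
  HC.of_subset hμ (fun _ hz => ⟨x, hx, hz, hc⟩) hc

theorem HC.pair_set {μ x y : ZFSet.{0}} (hμ : ℵ₀ ≤ #μ.toSet) (hx : x ∈ HC μ) (hy : y ∈ HC μ) :
    ({x, y} : ZFSet.{0}) ∈ HC μ := by
  refine HC.of_subset hμ (fun z hz => ?_) ?_
  · rcases ZFSet.mem_pair.1 hz with rfl | rfl <;> assumption
  · have : ({x, y} : ZFSet.{0}).toSet = ({x, y} : Set ZFSet.{0}) := by
      ext w; simp [mem_toSet]
    rw [this]
    exact (Set.Finite.lt_aleph0 (by simp)).le.trans hμ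

theorem HC.pair {μ x y : ZFSet.{0}} (hμ : ℵ₀ ≤ #μ.toSet) (hx : x ∈ HC μ) (hy : y ∈ HC μ) :
    ZFSet.pair x y ∈ HC μ := by
  unfold ZFSet.pair
  refine HC.pair_set hμ ?_ (HC.pair_set hμ hx hy)
  rw [← ZFSet.pair_eq_singleton]
  exact HC.pair_set hμ hx hx

theorem HC.mono {μ ν x : ZFSet.{0}} (h : #μ.toSet ≤ #ν.toSet) (hx : x ∈ HC μ) : x ∈ HC ν := by
  obtain ⟨t, h1, h2, h3⟩ := hx
  exact ⟨t, h1, h2, h3.trans h⟩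

theorem HC_subset_Hset {μ κ : ZFSet.{0}} (h : μ ∈ κ) : HC μ ⊆ Hset κ := by
  rintro x ⟨t, h1, h2, h3⟩
  exact ⟨t, h1, h2, μ, h, h3⟩

theorem exists_HC_of_mem_Hset {κ x : ZFSet.{0}} (hx : x ∈ Hset κ) : ∃ μ ∈ κ, x ∈ HC μ := by
  obtain ⟨t, h1, h2, μ, h, h3⟩ := hx
  obtain ⟨f⟩ := h3
  exact ⟨μ, h, t, h1, h2, ⟨f⟩⟩

/-! ### Skolem closures -/

/-- Closure of a set under choice functions for the predicates in `P`. -/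
inductive Cl (P : Set (List ZFSet.{0} → ZFSet.{0} → Prop)) (A : Set ZFSet.{0}) :
    ZFSet.{0} → Prop
  | base {x : ZFSet.{0}} : x ∈ A → Cl P A x
  | step {p : List ZFSet.{0} → ZFSet.{0} → Prop} (hp : p ∈ P) (l : List ZFSet.{0})
      (hl : ∀ x ∈ l, Cl P A x) (h : ∃ w, p l w) : Cl P A h.choose

theorem Cl.exists {P : Set (List ZFSet.{0} → ZFSet.{0} → Prop)} {A : Set ZFSet.{0}}
    {p : List ZFSet.{0} → ZFSet.{0} → Prop} (hp : p ∈ P) (l : List ZFSet.{0})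
    (hl : ∀ x ∈ l, Cl P A x) (h : ∃ w, p l w) : ∃ w, Cl P A w ∧ p l w :=
  ⟨_, Cl.step hp l hl h, h.choose_spec⟩

theorem Cl.mono {P : Set (List ZFSet.{0} → ZFSet.{0} → Prop)} {A B : Set ZFSet.{0}}
    (hAB : ∀ x ∈ A, Cl P B x) {x : ZFSet.{0}} (hx : Cl P A x) : Cl P B x := by
  induction hx with
  | base h => exact hAB _ h
  | step hp l _ h ih => exact Cl.step hp l ih h

theorem Cl.finite {P : Set (List ZFSet.{0} → ZFSet.{0} → Prop)} {A : Set ZFSet.{0}}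
    {x : ZFSet.{0}} (hx : Cl P A x) :
    ∃ l : List ZFSet.{0}, (∀ a ∈ l, a ∈ A) ∧ Cl P {a | a ∈ l} x := by
  induction hx with
  | @base x h => exact ⟨[x], by simpa using h, Cl.base (by simp)⟩
  | @step p hp l _ h ih =>
    choose! L hL1 hL2 using ih
    refine ⟨l.flatMap L, ?_, Cl.step hp l (fun x hx => (hL2 x hx).mono fun a ha => Cl.base ?_) h⟩
    · intro a ha
      obtain ⟨b, hb, hab⟩ := List.mem_flatMap.1 ha
      exact hL1 b hb a hab
    · exact List.mem_flatMap.2 ⟨x, hx, ha⟩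

/-- The stages of the closure `Cl`. -/
def clStage (P : Set (List ZFSet.{0} → ZFSet.{0} → Prop)) (A : Set ZFSet.{0}) :
    ℕ → Set ZFSet.{0}
  | 0 => A
  | n + 1 => clStage P A n ∪ Set.range fun q : P × List (clStage P A n) =>
      if h : ∃ w, q.1.1 (q.2.map Subtype.val) w then h.choose else ∅

theorem clStage_mono {P : Set (List ZFSet.{0} → ZFSet.{0} → Prop)} {A : Set ZFSet.{0}} :
    Monotone (clStage P A) :=
  monotone_nat_of_le_succ fun _ => Set.subset_union_left

theorem mem_clStage {P : Set (List ZFSet.{0} → ZFSet.{0} → Prop)} {A : Set ZFSet.{0}}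
    {x : ZFSet.{0}} (hx : Cl P A x) : ∃ n, x ∈ clStage P A n := by
  induction hx with
  | base h => exact ⟨0, h⟩
  | @step p hp l _ h ih =>
    choose! N hN using ih
    obtain ⟨M, hM⟩ : ∃ M, ∀ x ∈ l, N x ≤ M := by
      clear hN h
      induction l with
      | nil => exact ⟨0, by simp⟩
      | cons a l ih =>
        obtain ⟨M, hM⟩ := ih (fun x hx => by simp_all)
        refine ⟨max M (N a), ?_⟩
        simp only [List.mem_cons, forall_eq_or_imp, le_max_right, true_and]
        exact fun x hx => (hM x hx).trans (le_max_left _ _)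
    have hmem : ∀ x ∈ l, x ∈ clStage P A M := fun x hx => clStage_mono (hM x hx) (hN x hx)
    lift l to List (clStage P A M) using hmem
    refine ⟨M + 1, Or.inr ⟨(⟨p, hp⟩, l), ?_⟩⟩
    exact dif_pos h

theorem mk_Cl_le {P : Set (List ZFSet.{0} → ZFSet.{0} → Prop)} (hP : P.Countable)
    {A : Set ZFSet.{0}} {m : Cardinal.{1}} (hm : ℵ₀ ≤ m) (hA : #A ≤ m) :
    #{x | Cl P A x} ≤ m := by
  have hst : ∀ n, #(clStage P A n) ≤ m := by
    intro n
    induction n with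
    | zero => exact hA
    | succ n ih =>
      refine (mk_union_le _ _).trans (add_le_of_le hm ih (mk_range_le.trans ?_))
      rw [mk_prod, lift_id, lift_id]
      refine (mul_le_mul' (hP.le_aleph0.trans hm) ?_).trans (mul_eq_self hm).le
      exact (mk_list_le_max _).trans (max_le hm ih)
  have hsub : {x | Cl P A x} ⊆ ⋃ n, clStage P A n := fun x hx =>
    Set.mem_iUnion.2 (mem_clStage hx)
  refine (mk_le_mk_of_subset hsub).trans ?_
  have := mk_iUnion_le_lift (fun n : ℕ => clStage P A n)
  simp only [lift_uzero, mk_nat, lift_aleph0] at this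
  refine this.trans ((mul_le_mul' hm (ciSup_le' hst)).trans (mul_eq_self hm).le)

/-- The closure as a `ZFSet`. -/
theorem exists_Cl_set {P : Set (List ZFSet.{0} → ZFSet.{0} → Prop)} (hP : P.Countable)
    {A : Set ZFSet.{0}} {μ : ZFSet.{0}} (hm : ℵ₀ ≤ #μ.toSet) (hA : #A ≤ #μ.toSet) :
    ∃ Y : ZFSet.{0}, (∀ x, x ∈ Y ↔ Cl P A x) ∧ #Y.toSet ≤ #μ.toSet := by
  have h := mk_Cl_le hP hm hA
  obtain ⟨Y, hY⟩ := exists_toSet_eq h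
  exact ⟨Y, fun x => by rw [← mem_toSet, hY]; rfl, hY ▸ h⟩

/-! ### Sets closed under enough Skolem functions, and condensation -/

/-- The subset of `Lstage δ` defined by `φ` with parameters `v`. -/
def defPart {n : ℕ} (φ : Fml (n + 1)) (δ : ZFSet.{0}) (v : Fin n → ZFSet.{0}) : ZFSet.{0} :=
  ZFSet.sep (fun z => Sat (Lstage δ).toSet φ (Fin.cons z v)) (Lstage δ)

theorem mem_defPart {n : ℕ} {φ : Fml (n + 1)} {δ z : ZFSet.{0}} {v : Fin n → ZFSet.{0}} :
    z ∈ defPart φ δ v ↔ z ∈ Lstage δ ∧ Sat (Lstage δ).toSet φ (Fin.cons z v) :=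
  ZFSet.mem_sep

/-- `Y` is closed under the Skolem functions needed for condensation. -/
structure Rich (Y : ZFSet.{0}) : Prop where
  ext : ∀ u ∈ Y, ∀ v ∈ Y, u ≠ v → ∃ z ∈ Y, (z ∈ u ∧ z ∉ v) ∨ (z ∈ v ∧ z ∉ u)
  upair : ∀ u ∈ Y, ∀ v ∈ Y, ({u, v} : ZFSet.{0}) ∈ Y
  fst : ∀ u v, ZFSet.pair u v ∈ Y → u ∈ Y
  snd : ∀ u v, ZFSet.pair u v ∈ Y → v ∈ Y
  app : ∀ f ∈ Y, ∀ z ∈ Y, (∃ w, ZFSet.pair z w ∈ f) → ∃ w ∈ Y, ZFSet.pair z w ∈ f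
  coapp : ∀ f ∈ Y, ∀ w ∈ Y, (∃ z, ZFSet.pair z w ∈ f) → ∃ z ∈ Y, ZFSet.pair z w ∈ f
  coll : ∀ u ∈ Y, ∀ y ∈ Y, collapse u y ∈ Y
  collMem : ∀ u ∈ Y, ∀ y ∈ Y, ∀ w ∈ Y, (∃ z, z ∈ y ∧ z ∈ u ∧ w = collapse u z) →
    ∃ z ∈ Y, z ∈ y ∧ z ∈ u ∧ w = collapse u z
  stage : ∀ β ∈ Y, ∀ z ∈ Y, (∃ δ, δ ∈ β ∧ z ∈ Dset (Lstage δ)) →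
    ∃ δ ∈ Y, δ ∈ β ∧ z ∈ Dset (Lstage δ)
  params : ∀ {n : ℕ} (φ : Fml (n + 1)), ∀ δ ∈ Y, ∀ z ∈ Y,
    (∃ v : Fin n → ZFSet.{0}, (∀ i, v i ∈ Lstage δ) ∧ z = defPart φ δ v) →
    ∃ v : Fin n → ZFSet.{0}, (∀ i, v i ∈ Y) ∧ (∀ i, v i ∈ Lstage δ) ∧ z = defPart φ δ v
  def_mem : ∀ {n : ℕ} (φ : Fml (n + 1)), ∀ δ ∈ Y, ∀ v : Fin n → ZFSet.{0}, (∀ i, v i ∈ Y) →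
    defPart φ δ v ∈ Y
  skolem : ∀ {n : ℕ} (φ : Fml (n + 1)), ∀ δ ∈ Y, ∀ v : Fin n → ZFSet.{0}, (∀ i, v i ∈ Y) →
    (∃ x ∈ Lstage δ, Sat (Lstage δ).toSet φ (Fin.cons x v)) →
    ∃ x ∈ Y, x ∈ Lstage δ ∧ Sat (Lstage δ).toSet φ (Fin.cons x v)

/-- Chosen parameters defining `z` over `Lstage δ` by means of `φ`. -/
def chosenParams {n : ℕ} (φ : Fml (n + 1)) (δ z : ZFSet.{0}) : Fin n → ZFSet.{0} :=
  if h : ∃ v : Fin n → ZFSet.{0}, (∀ i, v i ∈ Lstage δ) ∧ z = defPart φ δ v then h.choose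
  else fun _ => ∅

/-- The predicates whose Skolem functions define `Rich`. -/
def richPreds : Set (List ZFSet.{0} → ZFSet.{0} → Prop) :=
  ({ fun l z => ∃ u v, l = [u, v] ∧ ((z ∈ u ∧ z ∉ v) ∨ (z ∈ v ∧ z ∉ u)),
     fun l z => ∃ u v, l = [u, v] ∧ z = {u, v},
     fun l z => ∃ u v, l = [ZFSet.pair u v] ∧ z = u,
     fun l z => ∃ u v, l = [ZFSet.pair u v] ∧ z = v,
     fun l w => ∃ f z, l = [f, z] ∧ ZFSet.pair z w ∈ f,
     fun l z => ∃ f w, l = [f, w] ∧ ZFSet.pair z w ∈ f,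
     fun l w => ∃ u y, l = [u, y] ∧ w = collapse u y,
     fun l z => ∃ u y w, l = [u, y, w] ∧ z ∈ y ∧ z ∈ u ∧ w = collapse u z,
     fun l δ => ∃ β z, l = [β, z] ∧ δ ∈ β ∧ z ∈ Dset (Lstage δ) } :
    Set (List ZFSet.{0} → ZFSet.{0} → Prop)) ∪
  (Set.range fun (q : Σ n : ℕ, Fml (n + 1) × Fin n) (l : List ZFSet.{0}) (w : ZFSet.{0}) =>
    ∃ δ z, l = [δ, z] ∧ w = chosenParams q.2.1 δ z q.2.2) ∪
  (Set.range fun (q : Σ n : ℕ, Fml (n + 1)) (l : List ZFSet.{0}) (w : ZFSet.{0}) =>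
    ∃ δ v, l = δ :: List.ofFn v ∧ w = defPart q.2 δ v) ∪
  (Set.range fun (q : Σ n : ℕ, Fml (n + 1)) (l : List ZFSet.{0}) (x : ZFSet.{0}) =>
    ∃ δ v, l = δ :: List.ofFn v ∧ x ∈ Lstage δ ∧ Sat (Lstage δ).toSet q.2 (Fin.cons x v))

theorem richPreds_countable : richPreds.Countable := by
  unfold richPreds
  refine Set.Countable.union (Set.Countable.union (Set.Countable.union ?_ ?_) ?_) ?_
  · exact Set.Finite.countable (by simp)
  all_goals exact Set.countable_range _

theorem exists_rich {A : Set ZFSet.{0}} {μ : ZFSet.{0}} (hm : ℵ₀ ≤ #μ.toSet)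
    (hA : #A ≤ #μ.toSet) :
    ∃ Y : ZFSet.{0}, Rich Y ∧ (∀ x ∈ A, x ∈ Y) ∧ #Y.toSet ≤ #μ.toSet := by
  obtain ⟨Y, hY, hc⟩ := exists_Cl_set richPreds_countable hm hA
  have key : ∀ p ∈ richPreds, ∀ l : List ZFSet.{0}, (∀ x ∈ l, x ∈ Y) → (∃ w, p l w) →
      ∃ w ∈ Y, p l w := by
    intro p hp l hl h
    obtain ⟨w, h1, h2⟩ := Cl.exists hp l (fun x hx => (hY x).1 (hl x hx)) h
    exact ⟨w, (hY w).2 h1, h2⟩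
  refine ⟨Y, ?_, fun x hx => (hY x).2 (Cl.base hx), hc⟩
  constructor
  case ext =>
    intro u hu v hv huv
    have hne : ∃ z, (z ∈ u ∧ z ∉ v) ∨ (z ∈ v ∧ z ∉ u) := by
      by_contra! hcon
      exact huv (ZFSet.ext fun z => ⟨(hcon z).1, (hcon z).2⟩)
    obtain ⟨z, hz, u', v', hl, h⟩ := key
      (fun l z => ∃ u v, l = [u, v] ∧ ((z ∈ u ∧ z ∉ v) ∨ (z ∈ v ∧ z ∉ u)))
      (by simp [richPreds]) [u, v] (by simp [hu, hv]) (hne.imp fun z hz => ⟨u, v, rfl, hz⟩)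
    simp only [List.cons.injEq, and_true] at hl
    obtain ⟨rfl, rfl⟩ := hl
    exact ⟨z, hz, h⟩
  case upair =>
    intro u hu v hv
    obtain ⟨z, hz, u', v', hl, rfl⟩ := key (fun l z => ∃ u v, l = [u, v] ∧ z = {u, v})
      (by simp [richPreds]) [u, v] (by simp [hu, hv]) ⟨_, u, v, rfl, rfl⟩
    simp only [List.cons.injEq, and_true] at hl
    obtain ⟨rfl, rfl⟩ := hl
    exact hz
  case fst =>
    intro u v hp
    obtain ⟨z, hz, u', v', hl, rfl⟩ := key (fun l z => ∃ u v, l = [ZFSet.pair u v] ∧ z = u)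
      (by simp [richPreds]) [ZFSet.pair u v] (by simp [hp]) ⟨_, u, v, rfl, rfl⟩
    simp only [List.cons.injEq, and_true, ZFSet.pair_inj] at hl
    exact hl.1 ▸ hz
  case snd =>
    intro u v hp
    obtain ⟨z, hz, u', v', hl, rfl⟩ := key (fun l z => ∃ u v, l = [ZFSet.pair u v] ∧ z = v)
      (by simp [richPreds]) [ZFSet.pair u v] (by simp [hp]) ⟨_, u, v, rfl, rfl⟩
    simp only [List.cons.injEq, and_true, ZFSet.pair_inj] at hl
    exact hl.2 ▸ hz
  case app =>
    intro f hf z hz hex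
    obtain ⟨w, hw, f', z', hl, h⟩ := key (fun l w => ∃ f z, l = [f, z] ∧ ZFSet.pair z w ∈ f)
      (by simp [richPreds]) [f, z] (by simp [hf, hz]) (hex.imp fun w hw => ⟨f, z, rfl, hw⟩)
    simp only [List.cons.injEq, and_true] at hl
    obtain ⟨rfl, rfl⟩ := hl
    exact ⟨w, hw, h⟩
  case coapp =>
    intro f hf z hz hex
    obtain ⟨w, hw, f', z', hl, h⟩ := key (fun l z => ∃ f w, l = [f, w] ∧ ZFSet.pair z w ∈ f)
      (by simp [richPreds]) [f, z] (by simp [hf, hz]) (hex.imp fun w hw => ⟨f, z, rfl, hw⟩)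
    simp only [List.cons.injEq, and_true] at hl
    obtain ⟨rfl, rfl⟩ := hl
    exact ⟨w, hw, h⟩
  case coll =>
    intro u hu v hv
    obtain ⟨z, hz, u', v', hl, rfl⟩ := key (fun l w => ∃ u y, l = [u, y] ∧ w = collapse u y)
      (by simp [richPreds]) [u, v] (by simp [hu, hv]) ⟨_, u, v, rfl, rfl⟩
    simp only [List.cons.injEq, and_true] at hl
    obtain ⟨rfl, rfl⟩ := hl
    exact hz
  case collMem =>
    intro u hu y hy w hw hex
    obtain ⟨z, hz, u', y', w', hl, h⟩ := key
      (fun l z => ∃ u y w, l = [u, y, w] ∧ z ∈ y ∧ z ∈ u ∧ w = collapse u z)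
      (by simp [richPreds]) [u, y, w] (by simp [hu, hy, hw])
      (hex.imp fun z hz => ⟨u, y, w, rfl, hz⟩)
    simp only [List.cons.injEq, and_true] at hl
    obtain ⟨rfl, rfl, rfl⟩ := hl
    exact ⟨z, hz, h⟩
  case stage =>
    intro f hf z hz hex
    obtain ⟨w, hw, f', z', hl, h⟩ := key
      (fun l δ => ∃ β z, l = [β, z] ∧ δ ∈ β ∧ z ∈ Dset (Lstage δ))
      (by simp [richPreds]) [f, z] (by simp [hf, hz]) (hex.imp fun w hw => ⟨f, z, rfl, hw⟩)
    simp only [List.cons.injEq, and_true] at hl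
    obtain ⟨rfl, rfl⟩ := hl
    exact ⟨w, hw, h⟩
  case params =>
    intro n φ δ hδ z hz hex
    refine ⟨chosenParams φ δ z, fun i => ?_, ?_⟩
    · obtain ⟨w, hw, δ', z', hl, rfl⟩ := key
        (fun l w => ∃ δ z, l = [δ, z] ∧ w = chosenParams φ δ z i)
        (Or.inl (Or.inl (Or.inr ⟨⟨n, φ, i⟩, rfl⟩))) [δ, z] (by simp [hδ, hz])
        ⟨_, δ, z, rfl, rfl⟩
      simp only [List.cons.injEq, and_true] at hl
      obtain ⟨rfl, rfl⟩ := hl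
      exact hw
    · unfold chosenParams
      rw [dif_pos hex]
      exact hex.choose_spec
  case def_mem =>
    intro n φ δ hδ v hv
    obtain ⟨w, hw, δ', v', hl, rfl⟩ := key
      (fun l w => ∃ δ v, l = δ :: List.ofFn v ∧ w = defPart φ δ v)
      (Or.inl (Or.inr ⟨⟨n, φ⟩, rfl⟩)) (δ :: List.ofFn v)
      (by simpa [hδ, List.mem_ofFn] using hv) ⟨_, δ, v, rfl, rfl⟩
    simp only [List.cons.injEq] at hl
    obtain ⟨rfl, hv'⟩ := hl
    rwa [List.ofFn_injective hv']
  case skolem =>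
    intro n φ δ hδ v hv hex
    obtain ⟨w, hw, δ', v', hl, h⟩ := key
      (fun l x => ∃ δ v, l = δ :: List.ofFn v ∧ x ∈ Lstage δ ∧
        Sat (Lstage δ).toSet φ (Fin.cons x v))
      (Or.inr ⟨⟨n, φ⟩, rfl⟩) (δ :: List.ofFn v)
      (by simpa [hδ, List.mem_ofFn] using hv) (hex.imp fun x hx => ⟨δ, v, rfl, hx⟩)
    simp only [List.cons.injEq] at hl
    obtain ⟨rfl, hv'⟩ := hl
    rw [← List.ofFn_injective hv'] at h
    exact ⟨w, hw, h⟩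

namespace Rich

variable {Y : ZFSet.{0}}

theorem collapse_inj (h : Rich Y) : ∀ u ∈ Y, ∀ v ∈ Y, collapse Y u = collapse Y v → u = v := by
  intro u
  induction u using ZFSet.inductionOn with
  | _ u ih =>
    intro hu v hv he
    by_contra hne
    obtain ⟨z, hz, ⟨h1, h2⟩ | ⟨h1, h2⟩⟩ := h.ext u hu v hv hne
    · have : collapse Y z ∈ collapse Y v := he ▸ mem_collapse.2 ⟨z, h1, hz, rfl⟩
      obtain ⟨z', h3, h4, h5⟩ := mem_collapse.1 this
      exact h2 (ih z h1 hz z' h4 h5 ▸ h3)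
    · have : collapse Y z ∈ collapse Y u := he ▸ mem_collapse.2 ⟨z, h1, hz, rfl⟩
      obtain ⟨z', h3, h4, h5⟩ := mem_collapse.1 this
      exact h2 (ih z' h3 h4 z hz h5.symm ▸ h3)

theorem collapse_mem (h : Rich Y) {z u : ZFSet.{0}} (hz : z ∈ Y) :
    collapse Y z ∈ collapse Y u ↔ z ∈ u := by
  rw [mem_collapse]
  constructor
  · rintro ⟨z', h1, h2, h3⟩
    rwa [h.collapse_inj z hz z' h2 h3]
  · exact fun hzu => ⟨z, hzu, hz, rfl⟩

theorem collapse_upair {u v : ZFSet.{0}} (hu : u ∈ Y) (hv : v ∈ Y) :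
    collapse Y {u, v} = {collapse Y u, collapse Y v} := by
  ext w
  rw [mem_collapse, ZFSet.mem_pair]
  constructor
  · rintro ⟨z, h1, h2, rfl⟩
    rcases ZFSet.mem_pair.1 h1 with rfl | rfl <;> simp
  · rintro (rfl | rfl)
    · exact ⟨u, by simp, hu, rfl⟩
    · exact ⟨v, by simp, hv, rfl⟩

theorem pair_mem (h : Rich Y) {u v : ZFSet.{0}} (hu : u ∈ Y) (hv : v ∈ Y) :
    ZFSet.pair u v ∈ Y := by
  unfold ZFSet.pair
  rw [← ZFSet.pair_eq_singleton]
  exact h.upair _ (h.upair _ hu _ hu) _ (h.upair _ hu _ hv)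

theorem collapse_pair (h : Rich Y) {u v : ZFSet.{0}} (hu : u ∈ Y) (hv : v ∈ Y) :
    collapse Y (ZFSet.pair u v) = ZFSet.pair (collapse Y u) (collapse Y v) := by
  unfold ZFSet.pair
  rw [← ZFSet.pair_eq_singleton u, ← ZFSet.pair_eq_singleton (collapse Y u),
    collapse_upair (h.upair _ hu _ hu) (h.upair _ hu _ hv), collapse_upair hu hu,
    collapse_upair hu hv]

theorem collapse_surj (h : Rich Y) {a b f : ZFSet.{0}} (hf : f ∈ Y)
    (hs : IsSurjF a b f) : IsSurjF (collapse Y a) (collapse Y b) (collapse Y f) := by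
  obtain ⟨⟨hsub, hfun⟩, hsurj⟩ := hs
  have hpr : ∀ {z w : ZFSet.{0}}, ZFSet.pair z w ∈ f → z ∈ a ∧ w ∈ b := fun hp =>
    ZFSet.pair_mem_prod.1 (hsub hp)
  have hpair : ∀ {q : ZFSet.{0}}, q ∈ collapse Y f → ∃ z w, z ∈ Y ∧ w ∈ Y ∧
      ZFSet.pair z w ∈ f ∧ q = ZFSet.pair (collapse Y z) (collapse Y w) := by
    intro q hq
    obtain ⟨p, h1, h2, rfl⟩ := mem_collapse.1 hq
    obtain ⟨z, hz, w, hw, rfl⟩ := ZFSet.mem_prod.1 (hsub h1)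
    exact ⟨z, w, h.fst _ _ h2, h.snd _ _ h2, h1, h.collapse_pair (h.fst _ _ h2) (h.snd _ _ h2)⟩
  have hin : ∀ {z w : ZFSet.{0}}, z ∈ Y → w ∈ Y → ZFSet.pair z w ∈ f →
      ZFSet.pair (collapse Y z) (collapse Y w) ∈ collapse Y f := by
    intro z w hz hw hp
    rw [← h.collapse_pair hz hw]
    exact mem_collapse.2 ⟨_, hp, h.pair_mem hz hw, rfl⟩
  refine ⟨⟨?_, ?_⟩, ?_⟩
  · intro q hq
    obtain ⟨z, w, hz, hw, hp, rfl⟩ := hpair hq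
    rw [ZFSet.pair_mem_prod]
    exact ⟨mem_collapse.2 ⟨z, (hpr hp).1, hz, rfl⟩, mem_collapse.2 ⟨w, (hpr hp).2, hw, rfl⟩⟩
  · intro z' hz'
    obtain ⟨z, h1, h2, rfl⟩ := mem_collapse.1 hz'
    obtain ⟨w0, hw0, huniq⟩ := hfun z h1
    obtain ⟨w, hw, hp⟩ := h.app f hf z h2 ⟨w0, hw0⟩
    refine ⟨collapse Y w, hin h2 hw hp, ?_⟩
    intro y hy
    obtain ⟨z1, w1, hz1, hw1, hp1, he⟩ := hpair hy
    obtain ⟨e1, rfl⟩ := ZFSet.pair_inj.1 he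
    have := h.collapse_inj _ h2 _ hz1 e1
    subst this
    rw [huniq w1 hp1, huniq w hp]
  · intro y hy
    obtain ⟨w, h1, h2, rfl⟩ := mem_collapse.1 hy
    obtain ⟨z, hz, hp⟩ := h.coapp f hf w h2 ((hsurj w h1).imp fun z hz => hz.2)
    exact ⟨_, mem_collapse.2 ⟨z, (hpr hp).1, hz, rfl⟩, hin hz h2 hp⟩

theorem sat_collapse (h : Rich Y) {δ : ZFSet.{0}} (hδ : δ ∈ Y)
    (hL : collapse Y (Lstage δ) = Lstage (collapse Y δ)) {n : ℕ} (φ : Fml n)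
    (v : Fin n → ZFSet.{0}) (hv : ∀ i, v i ∈ Y) :
    Sat (Lstage δ).toSet φ v ↔
      Sat (Lstage (collapse Y δ)).toSet φ fun i => collapse Y (v i) := by
  induction φ with
  | mem i j => simpa [Sat, SatAB] using (h.collapse_mem (hv i)).symm
  | eq i j =>
    simp only [Sat, SatAB]
    exact ⟨fun e => by rw [e], h.collapse_inj _ (hv i) _ (hv j)⟩
  | inA | inB => simp [Sat, SatAB]
  | not φ ih => simpa [Sat, SatAB] using not_congr (ih v hv)
  | and φ ψ ih1 ih2 => simpa [Sat, SatAB] using and_congr (ih1 v hv) (ih2 v hv)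
  | ex φ ih =>
    have hcons : ∀ x : ZFSet.{0}, (fun i => collapse Y ((Fin.cons x v : Fin _ → ZFSet.{0}) i)) =
        Fin.cons (collapse Y x) fun i => collapse Y (v i) := by
      intro x
      funext i
      refine Fin.cases ?_ (fun j => ?_) i <;> simp
    have ih' : ∀ x ∈ Y, (Sat (Lstage δ).toSet φ (Fin.cons x v) ↔
        Sat (Lstage (collapse Y δ)).toSet φ
          (Fin.cons (collapse Y x) fun i => collapse Y (v i))) := by
      intro x hx
      rw [← hcons]
      exact ih _ (fun i => Fin.cases (by simpa using hx) (fun j => by simpa using hv j) i)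
    constructor
    · intro hs
      obtain ⟨x, hx, hxL, hxs⟩ := h.skolem φ δ hδ v hv hs
      exact ⟨collapse Y x, hL ▸ mem_collapse.2 ⟨x, hxL, hx, rfl⟩, (ih' x hx).1 hxs⟩
    · rintro ⟨x', hx', hxs⟩
      rw [mem_toSet, ← hL] at hx'
      obtain ⟨x, hxL, hx, rfl⟩ := mem_collapse.1 hx'
      exact ⟨x, hxL, (ih' x hx).2 hxs⟩

theorem collapse_defPart (h : Rich Y) {δ : ZFSet.{0}} (hδ : δ ∈ Y)
    (hL : collapse Y (Lstage δ) = Lstage (collapse Y δ)) {n : ℕ} (φ : Fml (n + 1))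
    (v : Fin n → ZFSet.{0}) (hv : ∀ i, v i ∈ Y) :
    collapse Y (defPart φ δ v) = defPart φ (collapse Y δ) fun i => collapse Y (v i) := by
  have hs : ∀ x ∈ Y, (Sat (Lstage δ).toSet φ (Fin.cons x v) ↔
      Sat (Lstage (collapse Y δ)).toSet φ
        (Fin.cons (collapse Y x) fun i => collapse Y (v i))) := by
    intro x hx
    rw [h.sat_collapse hδ hL φ _
      (fun i => Fin.cases (by simpa using hx) (fun j => by simpa using hv j) i)]
    refine iff_of_eq (congrArg _ ?_)
    funext i
    refine Fin.cases ?_ (fun j => ?_) i <;> simp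
  ext w
  rw [mem_collapse, mem_defPart]
  constructor
  · rintro ⟨z, h1, h2, rfl⟩
    rw [mem_defPart] at h1
    exact ⟨hL ▸ mem_collapse.2 ⟨z, h1.1, h2, rfl⟩, (hs z h2).1 h1.2⟩
  · rintro ⟨h1, h2⟩
    rw [← hL] at h1
    obtain ⟨z, h3, h4, rfl⟩ := mem_collapse.1 h1
    exact ⟨z, mem_defPart.2 ⟨h3, (hs z h4).2 h2⟩, h4, rfl⟩

/-- Condensation. -/
theorem collapse_Lstage (h : Rich Y) : ∀ β ∈ Y,
    collapse Y (Lstage β) = Lstage (collapse Y β) := by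
  intro β
  induction β using ZFSet.inductionOn with
  | _ β ih =>
    intro hβ
    ext w
    rw [mem_collapse, mem_Lstage]
    constructor
    · rintro ⟨z, h1, h2, rfl⟩
      obtain ⟨δ, hδ, hδβ, hz⟩ := h.stage β hβ z h2 (mem_Lstage.1 h1)
      refine ⟨collapse Y δ, mem_collapse.2 ⟨δ, hδβ, hδ, rfl⟩, ?_⟩
      obtain ⟨n, φ, v0, hv0, hz0⟩ := mem_Dset.1 hz
      obtain ⟨v, hv, hin, hzv⟩ := h.params φ δ hδ z h2 ⟨v0, hv0, hz0⟩
      have hL := ih δ hδβ hδ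
      rw [hzv, h.collapse_defPart hδ hL φ v hv]
      exact mem_Dset.2 ⟨n, φ, _, fun i => hL ▸ mem_collapse.2 ⟨v i, hin i, hv i, rfl⟩, rfl⟩
    · rintro ⟨δ', hδ', hw⟩
      obtain ⟨δ, hδβ, hδ, rfl⟩ := mem_collapse.1 hδ'
      have hL := ih δ hδβ hδ
      obtain ⟨n, φ, v', hv', rfl⟩ := mem_Dset.1 hw
      have hv'' : ∀ i, ∃ x, x ∈ Lstage δ ∧ x ∈ Y ∧ v' i = collapse Y x := fun i =>
        mem_collapse.1 (hL ▸ hv' i)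
      choose v hv1 hv2 hv3 using hv''
      refine ⟨defPart φ δ v, mem_Lstage.2 ⟨δ, hδβ, mem_Dset.2 ⟨n, φ, v, hv1, rfl⟩⟩,
        h.def_mem φ δ hδ v hv2, ?_⟩
      rw [h.collapse_defPart hδ hL φ v hv2, ← funext hv3]
      rfl

theorem collapse_collapse (h : Rich Y) {u : ZFSet.{0}} (hu : u ∈ Y) : ∀ y ∈ Y,
    collapse Y (collapse u y) = collapse (Y ∩ u) y := by
  intro y
  induction y using ZFSet.inductionOn with
  | _ y ih =>
    intro hy
    ext w
    rw [mem_collapse, mem_collapse]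
    constructor
    · rintro ⟨x, h1, h2, rfl⟩
      obtain ⟨z, hz, hzy, hzu, rfl⟩ := h.collMem u hu y hy x h2 (mem_collapse.1 h1)
      exact ⟨z, hzy, ZFSet.mem_inter.2 ⟨hz, hzu⟩, ih z hzy hz⟩
    · rintro ⟨z, h1, h2, rfl⟩
      obtain ⟨h3, h4⟩ := ZFSet.mem_inter.1 h2
      exact ⟨collapse u z, mem_collapse.2 ⟨z, h1, h4, rfl⟩, h.coll u hu z h3, (ih z h1 h3).symm⟩

end Rich

/-- `a`, `f`, `β` witness that `η` is not an `L`-cardinal. -/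
def LSurj (η a f β : ZFSet.{0}) : Prop :=
  a ∈ η ∧ IsSurjF a η f ∧ IsOrd β ∧ f ∈ Lstage β

theorem not_LCard_iff {η : ZFSet.{0}} (hη : IsOrd η) :
    ¬ LCard η ↔ ∃ a f β, LSurj η a f β := by
  unfold LCard CardIn LClass LSurj
  constructor
  · intro h
    by_contra! hcon
    refine h ⟨hη, fun a ha f hf hs => ?_⟩
    obtain ⟨β, h1, h2⟩ := hf
    exact hcon a f β ha hs h1 h2
  · rintro ⟨a, f, β, h1, h2, h3, h4⟩ ⟨-, h5⟩
    exact h5 a h1 f ⟨β, h3, h4⟩ h2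

theorem LSurj.collapse {Y η a f β : ZFSet.{0}} (h : Rich Y) (ha : a ∈ Y) (hf : f ∈ Y)
    (hβ : β ∈ Y) (hs : LSurj η a f β) :
    LSurj (collapse Y η) (collapse Y a) (collapse Y f) (collapse Y β) :=
  ⟨mem_collapse.2 ⟨a, hs.1, ha, rfl⟩, h.collapse_surj hf hs.2.1, isOrd_collapse hs.2.2.1,
    h.collapse_Lstage β hβ ▸ mem_collapse.2 ⟨f, hs.2.2.2, hf, rfl⟩⟩

/-! ### Definability over a class -/

/-- The relation `R` is definable over `(S, ∈)` without parameters. -/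
def Dfn (S : Set ZFSet.{0}) (n : ℕ) (R : (Fin n → ZFSet.{0}) → Prop) : Prop :=
  ∃ φ : Fml n, ∀ v : Fin n → ZFSet.{0}, (∀ i, v i ∈ S) → (Sat S φ v ↔ R v)

namespace Dfn

variable {S : Set ZFSet.{0}} {n : ℕ}

theorem congr {R R' : (Fin n → ZFSet.{0}) → Prop} (h : Dfn S n R)
    (he : ∀ v : Fin n → ZFSet.{0}, (∀ i, v i ∈ S) → (R v ↔ R' v)) : Dfn S n R' := by
  obtain ⟨φ, hφ⟩ := h
  exact ⟨φ, fun v hv => (hφ v hv).trans (he v hv)⟩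

theorem mem (i j : Fin n) : Dfn S n fun v => v i ∈ v j :=
  ⟨.mem i j, fun v _ => by simp [Sat, SatAB]⟩

theorem eq (i j : Fin n) : Dfn S n fun v => v i = v j :=
  ⟨.eq i j, fun v _ => by simp [Sat, SatAB]⟩

theorem not {R : (Fin n → ZFSet.{0}) → Prop} (h : Dfn S n R) : Dfn S n fun v => ¬ R v := by
  obtain ⟨φ, hφ⟩ := h
  exact ⟨.not φ, fun v hv => by simpa [Sat, SatAB] using not_congr (hφ v hv)⟩

theorem and {R R' : (Fin n → ZFSet.{0}) → Prop} (h : Dfn S n R) (h' : Dfn S n R') :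
    Dfn S n fun v => R v ∧ R' v := by
  obtain ⟨φ, hφ⟩ := h
  obtain ⟨ψ, hψ⟩ := h'
  exact ⟨.and φ ψ, fun v hv => by simpa [Sat, SatAB] using and_congr (hφ v hv) (hψ v hv)⟩

theorem or {R R' : (Fin n → ZFSet.{0}) → Prop} (h : Dfn S n R) (h' : Dfn S n R') :
    Dfn S n fun v => R v ∨ R' v :=
  (h.not.and h'.not).not.congr fun v _ => by tauto

theorem imp {R R' : (Fin n → ZFSet.{0}) → Prop} (h : Dfn S n R) (h' : Dfn S n R') :
    Dfn S n fun v => R v → R' v :=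
  (h.and h'.not).not.congr fun v _ => by tauto

theorem iff {R R' : (Fin n → ZFSet.{0}) → Prop} (h : Dfn S n R) (h' : Dfn S n R') :
    Dfn S n fun v => R v ↔ R' v :=
  ((h.imp h').and (h'.imp h)).congr fun v _ => by tauto

theorem ex {P : ZFSet.{0} → (Fin n → ZFSet.{0}) → Prop}
    (h : Dfn S (n + 1) fun w => P (w 0) fun i => w i.succ) :
    Dfn S n fun v => ∃ x ∈ S, P x v := by
  obtain ⟨φ, hφ⟩ := h
  refine ⟨.ex φ, fun v hv => ?_⟩
  simp only [Sat, SatAB]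
  refine exists_congr fun x => and_congr_right fun hx => ?_
  have := hφ (Fin.cons x v) (fun i => Fin.cases (by simpa using hx) (by simpa using hv) i)
  simpa [Sat] using this

theorem all {P : ZFSet.{0} → (Fin n → ZFSet.{0}) → Prop}
    (h : Dfn S (n + 1) fun w => P (w 0) fun i => w i.succ) :
    Dfn S n fun v => ∀ x ∈ S, P x v :=
  (ex (P := fun x v => ¬ P x v) h.not).not.congr fun v _ => by push Not; rfl

theorem bex (hS : ∀ x ∈ S, ∀ y ∈ x, y ∈ S) {P : ZFSet.{0} → (Fin n → ZFSet.{0}) → Prop}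
    (i : Fin n) (h : Dfn S (n + 1) fun w => P (w 0) fun i => w i.succ) :
    Dfn S n fun v => ∃ x ∈ v i, P x v :=
  (ex (P := fun x v => x ∈ v i ∧ P x v) ((mem 0 i.succ).and h)).congr fun _ hv =>
    ⟨fun ⟨x, _, h⟩ => ⟨x, h⟩, fun ⟨x, hx, h⟩ => ⟨x, hS _ (hv i) x hx, hx, h⟩⟩

theorem ball (hS : ∀ x ∈ S, ∀ y ∈ x, y ∈ S) {P : ZFSet.{0} → (Fin n → ZFSet.{0}) → Prop}
    (i : Fin n) (h : Dfn S (n + 1) fun w => P (w 0) fun i => w i.succ) :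
    Dfn S n fun v => ∀ x ∈ v i, P x v :=
  (bex hS (P := fun x v => ¬ P x v) i h.not).not.congr fun v _ => by push Not; rfl

theorem empty (hS : ∀ x ∈ S, ∀ y ∈ x, y ∈ S) (i : Fin n) : Dfn S n fun v => v i = ∅ :=
  (ball hS (P := fun x v => ¬ x = x) i (eq 0 0).not).congr fun v _ => by
    simp [ZFSet.eq_empty]

theorem eq_upair (hS : ∀ x ∈ S, ∀ y ∈ x, y ∈ S) (i j k : Fin n) :
    Dfn S n fun v => v i = {v j, v k} :=
  ((mem j i).and ((mem k i).and (ball hS (P := fun x v => x = v j ∨ x = v k) i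
    ((eq 0 j.succ).or (eq 0 k.succ))))).congr fun v _ => by
    constructor
    · rintro ⟨h1, h2, h3⟩
      ext x
      rw [ZFSet.mem_pair]
      exact ⟨h3 x, by rintro (rfl | rfl) <;> assumption⟩
    · intro h
      rw [h]
      simp

theorem eq_pair (hS : ∀ x ∈ S, ∀ y ∈ x, y ∈ S) (i j k : Fin n) :
    Dfn S n fun v => v i = ZFSet.pair (v j) (v k) :=
  (bex hS (P := fun a v => ∃ b ∈ v i, a = {v j, v j} ∧ b = {v j, v k} ∧ v i = {a, b}) i
    (bex hS (P := fun b w => w 0 = {w j.succ, w j.succ} ∧ b = {w j.succ, w k.succ} ∧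
      w i.succ = {w 0, b}) i.succ
      ((eq_upair hS _ _ _).and ((eq_upair hS _ _ _).and (eq_upair hS _ _ _))))).congr
    fun v _ => by
    unfold ZFSet.pair
    constructor
    · rintro ⟨a, ha, b, hb, rfl, rfl, h⟩
      rw [h, ZFSet.pair_eq_singleton]
    · intro h
      rw [h]
      exact ⟨{v j}, by simp, {v j, v k}, by simp, by simp, rfl, rfl⟩

theorem pair_mem (hS : ∀ x ∈ S, ∀ y ∈ x, y ∈ S) (i j k : Fin n) :
    Dfn S n fun v => ZFSet.pair (v i) (v j) ∈ v k :=
  (bex hS (P := fun p v => p = ZFSet.pair (v i) (v j)) k (eq_pair hS _ _ _)).congr fun v _ => by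
    simp

theorem isTransitive (hS : ∀ x ∈ S, ∀ y ∈ x, y ∈ S) (i : Fin n) :
    Dfn S n fun v => (v i).IsTransitive :=
  ball hS (P := fun y v => ∀ z ∈ y, z ∈ v i) i (ball hS (P := fun z w => z ∈ w i.succ) 0 (mem _ _))

theorem isOrd (hS : ∀ x ∈ S, ∀ y ∈ x, y ∈ S) (i : Fin n) : Dfn S n fun v => IsOrd (v i) :=
  (isTransitive hS i).and (ball hS i (isTransitive hS 0))

theorem isSurjF (hS : ∀ x ∈ S, ∀ y ∈ x, y ∈ S) (i j k : Fin n) :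
    Dfn S n fun v => IsSurjF (v i) (v j) (v k) := by
  have h : Dfn S n fun v => (∀ p ∈ v k, ∃ z ∈ v i, ∃ w ∈ v j, p = ZFSet.pair z w) ∧
      (∀ z ∈ v i, ∃ w ∈ v j, ZFSet.pair z w ∈ v k ∧ ∀ w' ∈ v j, ZFSet.pair z w' ∈ v k → w' = w) ∧
      ∀ w ∈ v j, ∃ z ∈ v i, ZFSet.pair z w ∈ v k :=
    (ball hS _ (bex hS _ (bex hS _ (eq_pair hS _ _ _)))).and
      ((ball hS _ (bex hS _ ((pair_mem hS _ _ _).and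
        (ball hS _ ((pair_mem hS _ _ _).imp (eq _ _)))))).and
        (ball hS _ (bex hS _ (pair_mem hS _ _ _))))
  refine h.congr fun v _ => ?_
  constructor
  · rintro ⟨h1, h2, h3⟩
    refine ⟨⟨fun p hp => ?_, fun z hz => ?_⟩, h3⟩
    · obtain ⟨z, hz, w, hw, rfl⟩ := h1 p hp
      exact ZFSet.pair_mem_prod.2 ⟨hz, hw⟩
    · obtain ⟨w, hw, hp, huniq⟩ := h2 z hz
      refine ⟨w, hp, fun w' hw' => huniq w' ?_ hw'⟩
      obtain ⟨z1, _, w1, hw1, he⟩ := h1 _ hw'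
      rw [(ZFSet.pair_inj.1 he).2]
      exact hw1
  · rintro ⟨⟨h1, h2⟩, h3⟩
    refine ⟨fun p hp => ?_, fun z hz => ?_, h3⟩
    · exact ZFSet.mem_prod.1 (h1 hp)
    · obtain ⟨w, hp, huniq⟩ := h2 z hz
      exact ⟨w, (ZFSet.pair_mem_prod.1 (h1 hp)).2, hp, fun w' _ hw' => huniq w' hw'⟩

end Dfn

/-! ### An internal description of the definable power set -/

/-- Coding finite sequences as iterated pairs. -/
def enc : List ZFSet.{0} → ZFSet.{0}
  | [] => ∅
  | a :: l => ZFSet.pair a (enc l)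

theorem pair_ne_empty (x y : ZFSet.{0}) : ZFSet.pair x y ≠ ∅ := by
  intro h
  have : ({x} : ZFSet.{0}) ∈ ZFSet.pair x y := by simp [ZFSet.pair]
  rw [h] at this
  exact ZFSet.notMem_empty _ this

theorem enc_injective : Function.Injective enc := by
  intro l
  induction l with
  | nil =>
    rintro (_ | ⟨b, l'⟩) h
    · rfl
    · exact absurd h.symm (pair_ne_empty _ _)
  | cons a l ih =>
    rintro (_ | ⟨b, l'⟩) h
    · exact absurd h (pair_ne_empty _ _)
    · obtain ⟨rfl, h2⟩ := ZFSet.pair_inj.1 h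
      rw [ih h2]

theorem HC.empty {μ : ZFSet.{0}} (hμ : ℵ₀ ≤ #μ.toSet) : ∅ ∈ HC μ := by
  have h : (∅ : ZFSet.{0}).toSet = ∅ := by ext; simp [mem_toSet]
  exact HC.of_subset hμ (by simp [h]) (by simp [h])

theorem HC.enc {μ : ZFSet.{0}} (hμ : ℵ₀ ≤ #μ.toSet) : ∀ l : List ZFSet.{0},
    (∀ x ∈ l, x ∈ HC μ) → enc l ∈ HC μ
  | [], _ => HC.empty hμ
  | a :: l, h => HC.pair hμ (h a (by simp)) (HC.enc hμ l fun x hx => h x (by simp [hx]))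

/-- The code of a valuation. -/
def env {n : ℕ} (v : Fin n → ZFSet.{0}) : ZFSet.{0} := enc (List.ofFn v)

theorem env_zero (v : Fin 0 → ZFSet.{0}) : env v = ∅ := by simp [env, enc]

theorem env_succ {n : ℕ} (v : Fin (n + 1) → ZFSet.{0}) :
    env v = ZFSet.pair (v 0) (env fun i => v i.succ) := by simp [env, enc, List.ofFn_succ]

theorem env_cons {n : ℕ} (x : ZFSet.{0}) (v : Fin n → ZFSet.{0}) :
    env (Fin.cons x v : Fin (n + 1) → ZFSet.{0}) = ZFSet.pair x (env v) := by simp [env_succ]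

theorem env_injective {n : ℕ} {v w : Fin n → ZFSet.{0}} (h : env v = env w) : v = w :=
  List.ofFn_injective (enc_injective h)

theorem env_arity {n m : ℕ} {v : Fin n → ZFSet.{0}} {w : Fin m → ZFSet.{0}}
    (h : env v = env w) : n = m := by
  have := congrArg List.length (enc_injective h)
  simpa using this

/-- The codes of the valuations in `M` satisfying `P`. -/
def Rel (M : ZFSet.{0}) (n : ℕ) (P : (Fin n → ZFSet.{0}) → Prop) : Set ZFSet.{0} :=
  {e | ∃ v : Fin n → ZFSet.{0}, (∀ i, v i ∈ M) ∧ e = env v ∧ P v}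

theorem env_mem_Rel {M : ZFSet.{0}} {n : ℕ} {P : (Fin n → ZFSet.{0}) → Prop}
    {v : Fin n → ZFSet.{0}} : env v ∈ Rel M n P ↔ (∀ i, v i ∈ M) ∧ P v := by
  constructor
  · rintro ⟨w, h1, h2, h3⟩
    rw [env_injective h2]
    exact ⟨h1, h3⟩
  · exact fun h => ⟨v, h.1, rfl, h.2⟩

theorem pair_mem_Rel {M : ZFSet.{0}} {n : ℕ} {P : (Fin (n + 1) → ZFSet.{0}) → Prop}
    {x e : ZFSet.{0}} : ZFSet.pair x e ∈ Rel M (n + 1) P ↔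
      x ∈ M ∧ e ∈ Rel M n fun v => P (Fin.cons x v) := by
  constructor
  · rintro ⟨w, h1, h2, h3⟩
    rw [env_succ] at h2
    obtain ⟨rfl, rfl⟩ := ZFSet.pair_inj.1 h2
    refine ⟨h1 0, _, fun i => h1 i.succ, rfl, ?_⟩
    have e : (Fin.cons (w 0) fun i => w i.succ : Fin (n + 1) → ZFSet.{0}) = w :=
      Fin.cons_self_tail w
    change P (Fin.cons (w 0) fun i => w i.succ)
    rwa [e]
  · rintro ⟨hx, v, h1, rfl, h3⟩
    exact ⟨Fin.cons x v, fun i => Fin.cases (by simpa using hx) (by simpa using h1) i,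
      (env_cons x v).symm, h3⟩

theorem mem_Rel_succ {M : ZFSet.{0}} {n : ℕ} {P : (Fin (n + 1) → ZFSet.{0}) → Prop}
    {p : ZFSet.{0}} : p ∈ Rel M (n + 1) P ↔ ∃ x ∈ M, ∃ e, p = ZFSet.pair x e ∧
      e ∈ Rel M n fun v => P (Fin.cons x v) := by
  constructor
  · intro h
    obtain ⟨v, h1, h2, h3⟩ := id h
    rw [env_succ] at h2
    subst h2
    exact ⟨_, h1 0, _, rfl, (pair_mem_Rel.1 h).2⟩
  · rintro ⟨x, hx, e, rfl, he⟩
    exact pair_mem_Rel.2 ⟨hx, he⟩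

/-- `𝓕` is closed, in the sense of `S`, under the operations generating the relations
definable over `M`. -/
structure ClosedFam (S : Set ZFSet.{0}) (M 𝓕 : ZFSet.{0}) : Prop where
  unit : ∃ R ∈ 𝓕, ∀ e ∈ S, e ∈ R ↔ e = ∅
  cyl : ∀ R ∈ 𝓕, ∃ R' ∈ 𝓕, ∀ p ∈ S, p ∈ R' ↔ ∃ x ∈ M, ∃ e ∈ R, p = ZFSet.pair x e
  swap : ∀ R ∈ 𝓕, ∃ R' ∈ 𝓕, ∀ p ∈ S, p ∈ R' ↔ ∃ x ∈ S, ∃ y ∈ S, ∃ e ∈ S,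
    p = ZFSet.pair x (ZFSet.pair y e) ∧ ZFSet.pair y (ZFSet.pair x e) ∈ R
  epsilon : ∀ R ∈ 𝓕, ∃ R' ∈ 𝓕, ∀ p ∈ S, p ∈ R' ↔ ∃ x ∈ M, ∃ y ∈ M, ∃ e ∈ R,
    x ∈ y ∧ p = ZFSet.pair x (ZFSet.pair y e)
  diag : ∀ R ∈ 𝓕, ∃ R' ∈ 𝓕, ∀ p ∈ S, p ∈ R' ↔ ∃ x ∈ M, ∃ e ∈ R,
    p = ZFSet.pair x (ZFSet.pair x e)
  diff : ∀ R ∈ 𝓕, ∀ R₁ ∈ 𝓕, ∃ R' ∈ 𝓕, ∀ p ∈ S, p ∈ R' ↔ p ∈ R ∧ ¬ p ∈ R₁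
  proj : ∀ R ∈ 𝓕, ∃ R' ∈ 𝓕, ∀ e ∈ S, e ∈ R' ↔ ∃ x ∈ M, ZFSet.pair x e ∈ R

/-- Some member of `𝓕` is the set of codes of valuations satisfying `P`. -/
def InFam (M 𝓕 : ZFSet.{0}) (n : ℕ) (P : (Fin n → ZFSet.{0}) → Prop) : Prop :=
  ∃ R ∈ 𝓕, ∀ e, e ∈ R ↔ e ∈ Rel M n P

theorem InFam.congr {M 𝓕 : ZFSet.{0}} {n : ℕ} {P P' : (Fin n → ZFSet.{0}) → Prop}
    (h : InFam M 𝓕 n P) (he : ∀ v, (∀ i, v i ∈ M) → (P v ↔ P' v)) : InFam M 𝓕 n P' := by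
  obtain ⟨R, hR, h⟩ := h
  refine ⟨R, hR, fun e => (h e).trans ?_⟩
  exact exists_congr fun v => and_congr_right fun hv => and_congr_right fun _ => he v hv

/-- The classes over which the internal description of definability is correct. -/
structure GoodClass (S : Set ZFSet.{0}) : Prop where
  trans : ∀ x ∈ S, ∀ y ∈ x, y ∈ S
  local_HC : ∀ x ∈ S, ∃ μ : ZFSet.{0}, ℵ₀ ≤ #μ.toSet ∧ x ∈ HC μ ∧ HC μ ⊆ S
  pair : ∀ x ∈ S, ∀ y ∈ S, ZFSet.pair x y ∈ S

theorem mem_of_pair_mem {S : Set ZFSet.{0}} (hS : ∀ x ∈ S, ∀ y ∈ x, y ∈ S) {x y : ZFSet.{0}}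
    (h : ZFSet.pair x y ∈ S) : x ∈ S ∧ y ∈ S := by
  have h1 : ({x, y} : ZFSet.{0}) ∈ S := hS _ h _ (by simp [ZFSet.pair])
  exact ⟨hS _ h1 _ (by simp), hS _ h1 _ (by simp)⟩

namespace ClosedFam

variable {S : Set ZFSet.{0}} {M 𝓕 : ZFSet.{0}} {n : ℕ}

theorem env_mem (hS : GoodClass S) (hM : M ∈ S) {v : Fin n → ZFSet.{0}} (hv : ∀ i, v i ∈ M) :
    env v ∈ S := by
  obtain ⟨μ, h1, h2, h3⟩ := hS.local_HC M hM
  refine h3 (HC.enc h1 _ fun x hx => ?_)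
  obtain ⟨i, rfl⟩ := List.mem_ofFn.1 hx
  exact HC.trans h2 (hv i)

theorem rel_sub (hS : GoodClass S) (hM : M ∈ S) {P : (Fin n → ZFSet.{0}) → Prop} {e : ZFSet.{0}}
    (he : e ∈ Rel M n P) : e ∈ S := by
  obtain ⟨v, hv, rfl, -⟩ := he
  exact env_mem hS hM hv

theorem inFam_of (hS : GoodClass S) (hM : M ∈ S) (hF : 𝓕 ∈ S)
    {P : (Fin n → ZFSet.{0}) → Prop} {R : ZFSet.{0}} (hR : R ∈ 𝓕)
    (h : ∀ e ∈ S, e ∈ R ↔ e ∈ Rel M n P) : InFam M 𝓕 n P :=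
  ⟨R, hR, fun e => ⟨fun he => (h e (hS.trans R (hS.trans 𝓕 hF R hR) e he)).1 he,
    fun he => (h e (rel_sub hS hM he)).2 he⟩⟩

theorem in_unit (h : ClosedFam S M 𝓕) (hS : GoodClass S) (hM : M ∈ S) (hF : 𝓕 ∈ S) :
    InFam M 𝓕 0 fun _ => True := by
  obtain ⟨R, hR, h⟩ := h.unit
  refine inFam_of hS hM hF hR fun e he => (h e he).trans ?_
  constructor
  · rintro rfl
    exact ⟨Fin.elim0, fun i => i.elim0, (env_zero _).symm, trivial⟩
  · rintro ⟨v, -, rfl, -⟩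
    exact env_zero v

theorem in_cyl (h : ClosedFam S M 𝓕) (hS : GoodClass S) (hM : M ∈ S) (hF : 𝓕 ∈ S)
    {P : (Fin n → ZFSet.{0}) → Prop} (hP : InFam M 𝓕 n P) :
    InFam M 𝓕 (n + 1) fun w => P fun i => w i.succ := by
  obtain ⟨R₀, hR₀, hR₀P⟩ := hP
  obtain ⟨R, hR, h⟩ := h.cyl R₀ hR₀
  refine inFam_of hS hM hF hR fun e he => (h e he).trans ?_
  rw [mem_Rel_succ]
  refine exists_congr fun x => and_congr_right fun _ => exists_congr fun e => ?_
  simp only [Fin.cons_succ, hR₀P]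
  exact and_comm

theorem in_swap (h : ClosedFam S M 𝓕) (hS : GoodClass S) (hM : M ∈ S) (hF : 𝓕 ∈ S)
    {P : (Fin (n + 2) → ZFSet.{0}) → Prop} (hP : InFam M 𝓕 (n + 2) P) :
    InFam M 𝓕 (n + 2) fun w => P (Fin.cons (w 1) (Fin.cons (w 0) fun i => w i.succ.succ)) := by
  obtain ⟨R₀, hR₀, hR₀P⟩ := hP
  obtain ⟨R, hR, h⟩ := h.swap R₀ hR₀
  refine inFam_of hS hM hF hR fun e he => (h e he).trans ?_
  constructor
  · rintro ⟨x, _, y, _, e, _, rfl, hp⟩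
    rw [hR₀P, pair_mem_Rel, pair_mem_Rel] at hp
    rw [pair_mem_Rel, pair_mem_Rel]
    exact ⟨hp.2.1, hp.1, hp.2.2⟩
  · rw [mem_Rel_succ]
    rintro ⟨x, hx, e, rfl, he'⟩
    obtain ⟨y, hy, e, rfl, he''⟩ := mem_Rel_succ.1 he'
    refine ⟨x, hS.trans M hM x hx, y, hS.trans M hM y hy, e, rel_sub hS hM he'', rfl, ?_⟩
    rw [hR₀P, pair_mem_Rel, pair_mem_Rel]
    exact ⟨hy, hx, he''⟩

theorem in_epsilon (h : ClosedFam S M 𝓕) (hS : GoodClass S) (hM : M ∈ S) (hF : 𝓕 ∈ S)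
    {P : (Fin n → ZFSet.{0}) → Prop} (hP : InFam M 𝓕 n P) :
    InFam M 𝓕 (n + 2) fun w => w 0 ∈ w 1 ∧ P fun i => w i.succ.succ := by
  obtain ⟨R₀, hR₀, hR₀P⟩ := hP
  obtain ⟨R, hR, h⟩ := h.epsilon R₀ hR₀
  refine inFam_of hS hM hF hR fun e he => (h e he).trans ?_
  constructor
  · rintro ⟨x, hx, y, hy, e, he', hxy, rfl⟩
    rw [hR₀P] at he'
    rw [pair_mem_Rel, pair_mem_Rel]
    obtain ⟨v, h1, h2, h3⟩ := he'
    exact ⟨hx, hy, v, h1, h2, hxy, h3⟩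
  · rw [mem_Rel_succ]
    rintro ⟨x, hx, e, rfl, he'⟩
    obtain ⟨y, hy, e, rfl, v, h1, h2, hxy, h3⟩ := mem_Rel_succ.1 he'
    exact ⟨x, hx, y, hy, e, (hR₀P e).2 ⟨v, h1, h2, h3⟩, hxy, rfl⟩

theorem in_diag (h : ClosedFam S M 𝓕) (hS : GoodClass S) (hM : M ∈ S) (hF : 𝓕 ∈ S)
    {P : (Fin n → ZFSet.{0}) → Prop} (hP : InFam M 𝓕 n P) :
    InFam M 𝓕 (n + 2) fun w => w 0 = w 1 ∧ P fun i => w i.succ.succ := by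
  obtain ⟨R₀, hR₀, hR₀P⟩ := hP
  obtain ⟨R, hR, h⟩ := h.diag R₀ hR₀
  refine inFam_of hS hM hF hR fun e he => (h e he).trans ?_
  constructor
  · rintro ⟨x, hx, e, he', rfl⟩
    rw [hR₀P] at he'
    rw [pair_mem_Rel, pair_mem_Rel]
    obtain ⟨v, h1, h2, h3⟩ := he'
    exact ⟨hx, hx, v, h1, h2, rfl, h3⟩
  · rw [mem_Rel_succ]
    rintro ⟨x, hx, e, rfl, he'⟩
    obtain ⟨y, hy, e, rfl, v, h1, h2, hxy, h3⟩ := mem_Rel_succ.1 he'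
    have hxy' : x = y := hxy
    subst hxy'
    exact ⟨x, hx, e, (hR₀P e).2 ⟨v, h1, h2, h3⟩, rfl⟩

theorem in_diff (h : ClosedFam S M 𝓕) (hS : GoodClass S) (hM : M ∈ S) (hF : 𝓕 ∈ S)
    {P P' : (Fin n → ZFSet.{0}) → Prop} (hP : InFam M 𝓕 n P) (hP' : InFam M 𝓕 n P') :
    InFam M 𝓕 n fun v => P v ∧ ¬ P' v := by
  obtain ⟨R₀, hR₀, hR₀P⟩ := hP
  obtain ⟨R₁, hR₁, hR₁P⟩ := hP'
  obtain ⟨R, hR, h⟩ := h.diff R₀ hR₀ R₁ hR₁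
  refine inFam_of hS hM hF hR fun e he => (h e he).trans ?_
  rw [hR₀P, hR₁P]
  constructor
  · rintro ⟨⟨v, h1, rfl, h3⟩, h4⟩
    exact ⟨v, h1, rfl, h3, fun h5 => h4 ⟨v, h1, rfl, h5⟩⟩
  · rintro ⟨v, h1, rfl, h3, h4⟩
    exact ⟨⟨v, h1, rfl, h3⟩, fun h5 => h4 (env_mem_Rel.1 h5).2⟩

theorem in_and (h : ClosedFam S M 𝓕) (hS : GoodClass S) (hM : M ∈ S) (hF : 𝓕 ∈ S)
    {P P' : (Fin n → ZFSet.{0}) → Prop} (hP : InFam M 𝓕 n P) (hP' : InFam M 𝓕 n P') :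
    InFam M 𝓕 n fun v => P v ∧ P' v :=
  (h.in_diff hS hM hF hP (h.in_diff hS hM hF hP hP')).congr fun v _ => by tauto

theorem in_proj (h : ClosedFam S M 𝓕) (hS : GoodClass S) (hM : M ∈ S) (hF : 𝓕 ∈ S)
    {P : (Fin (n + 1) → ZFSet.{0}) → Prop} (hP : InFam M 𝓕 (n + 1) P) :
    InFam M 𝓕 n fun v => ∃ x ∈ M, P (Fin.cons x v) := by
  obtain ⟨R₀, hR₀, hR₀P⟩ := hP
  obtain ⟨R, hR, h⟩ := h.proj R₀ hR₀
  refine inFam_of hS hM hF hR fun e he => (h e he).trans ?_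
  simp only [hR₀P, pair_mem_Rel]
  constructor
  · rintro ⟨x, hx, -, v, h1, rfl, h3⟩
    exact ⟨v, h1, rfl, x, hx, h3⟩
  · rintro ⟨v, h1, rfl, x, hx, h3⟩
    exact ⟨x, hx, hx, v, h1, rfl, h3⟩

theorem in_full (h : ClosedFam S M 𝓕) (hS : GoodClass S) (hM : M ∈ S) (hF : 𝓕 ∈ S) :
    ∀ n : ℕ, InFam M 𝓕 n fun _ => True
  | 0 => h.in_unit hS hM hF
  | n + 1 => h.in_cyl hS hM hF (h.in_full hS hM hF n)

theorem in_eq_head (h : ClosedFam S M 𝓕) (hS : GoodClass S) (hM : M ∈ S) (hF : 𝓕 ∈ S) :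
    ∀ {n : ℕ} (k : Fin n), InFam M 𝓕 (n + 1) fun w => w 0 = w k.succ
  | 0, k => k.elim0
  | n + 1, k => by
    refine Fin.cases ?_ (fun k => ?_) k
    · exact (h.in_diag hS hM hF (h.in_full hS hM hF n)).congr fun v _ => by simp
    · exact (h.in_swap hS hM hF (h.in_cyl hS hM hF (h.in_eq_head hS hM hF k))).congr
        fun v _ => Iff.rfl

theorem in_mem_head (h : ClosedFam S M 𝓕) (hS : GoodClass S) (hM : M ∈ S) (hF : 𝓕 ∈ S) :
    ∀ {n : ℕ} (k : Fin n), InFam M 𝓕 (n + 1) fun w => w 0 ∈ w k.succ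
  | 0, k => k.elim0
  | n + 1, k => by
    refine Fin.cases ?_ (fun k => ?_) k
    · exact (h.in_epsilon hS hM hF (h.in_full hS hM hF n)).congr fun v _ => by simp
    · exact (h.in_swap hS hM hF (h.in_cyl hS hM hF (h.in_mem_head hS hM hF k))).congr
        fun v _ => Iff.rfl

theorem in_sat (h : ClosedFam S M 𝓕) (hS : GoodClass S) (hM : M ∈ S) (hF : 𝓕 ∈ S)
    (φ : Fml n) : InFam M 𝓕 n (Sat M.toSet φ) := by
  induction φ with
  | mem i j =>
    refine (h.in_proj hS hM hF (h.in_and hS hM hF (h.in_eq_head hS hM hF i)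
      (h.in_mem_head hS hM hF j))).congr fun v hv => ?_
    simp only [Fin.cons_zero, Fin.cons_succ, Sat, SatAB]
    exact ⟨fun ⟨x, _, e, hx⟩ => e ▸ hx, fun hx => ⟨v i, hv i, rfl, hx⟩⟩
  | eq i j =>
    refine (h.in_proj hS hM hF (h.in_and hS hM hF (h.in_eq_head hS hM hF i)
      (h.in_eq_head hS hM hF j))).congr fun v hv => ?_
    simp only [Fin.cons_zero, Fin.cons_succ, Sat, SatAB]
    exact ⟨fun ⟨x, _, e, hx⟩ => e ▸ hx, fun hx => ⟨v i, hv i, rfl, hx⟩⟩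
  | inA | inB =>
    refine (h.in_diff hS hM hF (h.in_full hS hM hF _) (h.in_full hS hM hF _)).congr
      fun v _ => ?_
    simp [Sat, SatAB]
  | not φ ih =>
    exact (h.in_diff hS hM hF (h.in_full hS hM hF _) ih).congr fun v _ => by simp [Sat, SatAB]
  | and φ ψ ih1 ih2 =>
    exact (h.in_and hS hM hF ih1 ih2).congr fun v _ => by simp [Sat, SatAB]
  | ex φ ih =>
    exact (h.in_proj hS hM hF ih).congr fun v _ => by simp [Sat, SatAB, mem_toSet]

end ClosedFam

/-- The description, inside `S`, of definability over `M`. -/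
def IsDef (S : Set ZFSet.{0}) (M B : ZFSet.{0}) : Prop :=
  (∀ z ∈ B, z ∈ M) ∧ ∀ 𝓕 ∈ S, ClosedFam S M 𝓕 →
    ∃ R ∈ 𝓕, ∃ e ∈ S, ∀ z ∈ M, z ∈ B ↔ ZFSet.pair z e ∈ R

namespace Dfn

variable {S : Set ZFSet.{0}} {n : ℕ}

theorem eq_pair₂ (hS : ∀ x ∈ S, ∀ y ∈ x, y ∈ S) (i j k l : Fin n) :
    Dfn S n fun v => v i = ZFSet.pair (v j) (ZFSet.pair (v k) (v l)) := by
  have h : Dfn S n fun v => ∃ s ∈ S, s = ZFSet.pair (v k) (v l) ∧ v i = ZFSet.pair (v j) s :=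
    ex ((eq_pair hS _ _ _).and (eq_pair hS _ _ _))
  refine h.congr fun v hv => ⟨?_, fun e => ⟨_, ?_, rfl, e⟩⟩
  · rintro ⟨s, _, rfl, e⟩
    exact e
  · have := hv i
    rw [e] at this
    exact (mem_of_pair_mem hS this).2

theorem pair₂_mem (hS : ∀ x ∈ S, ∀ y ∈ x, y ∈ S) (i j k l : Fin n) :
    Dfn S n fun v => ZFSet.pair (v i) (ZFSet.pair (v j) (v k)) ∈ v l :=
  (bex hS (P := fun p v => p = ZFSet.pair (v i) (ZFSet.pair (v j) (v k))) l
    (eq_pair₂ hS _ _ _ _)).congr fun v _ => by simp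

theorem closedFam (hS : ∀ x ∈ S, ∀ y ∈ x, y ∈ S) (i j : Fin n) :
    Dfn S n fun v => ClosedFam S (v i) (v j) := by
  have h1 : Dfn S n fun v => ∃ R ∈ v j, ∀ e ∈ S, e ∈ R ↔ e = ∅ :=
    bex hS _ (all ((mem _ _).iff (empty hS _)))
  have h2 : Dfn S n fun v => ∀ R ∈ v j, ∃ R' ∈ v j, ∀ p ∈ S, p ∈ R' ↔
      ∃ x ∈ v i, ∃ e ∈ R, p = ZFSet.pair x e :=
    ball hS _ (bex hS _ (all ((mem _ _).iff (bex hS _ (bex hS _ (eq_pair hS _ _ _))))))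
  have h3 : Dfn S n fun v => ∀ R ∈ v j, ∃ R' ∈ v j, ∀ p ∈ S, p ∈ R' ↔
      ∃ x ∈ S, ∃ y ∈ S, ∃ e ∈ S,
        p = ZFSet.pair x (ZFSet.pair y e) ∧ ZFSet.pair y (ZFSet.pair x e) ∈ R :=
    ball hS _ (bex hS _ (all ((mem _ _).iff
      (ex (ex (ex ((eq_pair₂ hS _ _ _ _).and (pair₂_mem hS _ _ _ _))))))))
  have h4 : Dfn S n fun v => ∀ R ∈ v j, ∃ R' ∈ v j, ∀ p ∈ S, p ∈ R' ↔
      ∃ x ∈ v i, ∃ y ∈ v i, ∃ e ∈ R, x ∈ y ∧ p = ZFSet.pair x (ZFSet.pair y e) :=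
    ball hS _ (bex hS _ (all ((mem _ _).iff
      (bex hS _ (bex hS _ (bex hS _ ((mem _ _).and (eq_pair₂ hS _ _ _ _))))))))
  have h5 : Dfn S n fun v => ∀ R ∈ v j, ∃ R' ∈ v j, ∀ p ∈ S, p ∈ R' ↔
      ∃ x ∈ v i, ∃ e ∈ R, p = ZFSet.pair x (ZFSet.pair x e) :=
    ball hS _ (bex hS _ (all ((mem _ _).iff (bex hS _ (bex hS _ (eq_pair₂ hS _ _ _ _))))))
  have h6 : Dfn S n fun v => ∀ R ∈ v j, ∀ R₁ ∈ v j, ∃ R' ∈ v j, ∀ p ∈ S, p ∈ R' ↔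
      p ∈ R ∧ ¬ p ∈ R₁ :=
    ball hS _ (ball hS _ (bex hS _ (all ((mem _ _).iff ((mem _ _).and (mem _ _).not)))))
  have h7 : Dfn S n fun v => ∀ R ∈ v j, ∃ R' ∈ v j, ∀ e ∈ S, e ∈ R' ↔
      ∃ x ∈ v i, ZFSet.pair x e ∈ R :=
    ball hS _ (bex hS _ (all ((mem _ _).iff (bex hS _ (pair_mem hS _ _ _)))))
  refine (h1.and (h2.and (h3.and (h4.and (h5.and (h6.and h7)))))).congr fun v _ => ?_
  exact ⟨fun ⟨a, b, c, d, e, f, g⟩ => ⟨a, b, c, d, e, f, g⟩,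
    fun ⟨a, b, c, d, e, f, g⟩ => ⟨a, b, c, d, e, f, g⟩⟩

theorem isDef (hS : ∀ x ∈ S, ∀ y ∈ x, y ∈ S) (i j : Fin n) :
    Dfn S n fun v => IsDef S (v i) (v j) :=
  (ball hS _ (mem _ _)).and (all ((closedFam hS _ _).imp
    (bex hS _ (ex (ball hS _ ((mem _ _).iff (pair_mem hS _ _ _)))))))

end Dfn

/-- A formula that is never satisfied. -/
def falseFml (n : ℕ) : Fml n := .ex (.not (.eq 0 0))

theorem sat_falseFml {S : Set ZFSet.{0}} {n : ℕ} (v : Fin n → ZFSet.{0}) :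
    ¬ Sat S (falseFml n) v := by simp [falseFml, Sat, SatAB]

theorem exists_satFamily {M μ : ZFSet.{0}} (hμ : ℵ₀ ≤ #μ.toSet) (hM : M ∈ HC μ) :
    ∃ 𝓕 ∈ HC μ, (∀ R ∈ 𝓕, ∃ (n : ℕ) (φ : Fml n), ∀ e, e ∈ R ↔ e ∈ Rel M n (Sat M.toSet φ)) ∧
      ∀ (n : ℕ) (φ : Fml n), ∃ R ∈ 𝓕, ∀ e, e ∈ R ↔ e ∈ Rel M n (Sat M.toSet φ) := by
  have hR : ∀ q : Σ n : ℕ, Fml n, ∃ z ∈ HC μ, ∀ e, e ∈ z ↔ e ∈ Rel M q.1 (Sat M.toSet q.2) := by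
    rintro ⟨n, φ⟩
    refine HC.of_set hμ ?_ ?_
    · rintro _ ⟨v, hv, rfl, -⟩
      refine HC.enc hμ _ fun x hx => ?_
      obtain ⟨i, rfl⟩ := List.mem_ofFn.1 hx
      exact HC.trans hM (hv i)
    · have hsub : Rel M n (Sat M.toSet φ) ⊆
          Set.range fun l : List M.toSet => enc (l.map Subtype.val) := by
        rintro _ ⟨v, hv, rfl, -⟩
        refine ⟨List.ofFn fun i => (⟨v i, hv i⟩ : M.toSet), ?_⟩
        simp [env, List.map_ofFn, Function.comp_def]
      refine (mk_le_mk_of_subset hsub).trans (mk_range_le.trans ((mk_list_le_max _).trans ?_))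
      exact max_le hμ (HC.card_le hM)
  choose z hz hze using hR
  obtain ⟨𝓕, hF, hFe⟩ := HC.of_set hμ (X := Set.range z) (by rintro _ ⟨q, rfl⟩; exact hz q)
    ((Set.countable_range z).le_aleph0.trans hμ)
  refine ⟨𝓕, hF, fun R hR => ?_, fun n φ => ⟨z ⟨n, φ⟩, (hFe _).2 ⟨_, rfl⟩, hze _⟩⟩
  obtain ⟨q, rfl⟩ := (hFe R).1 hR
  exact ⟨q.1, q.2, hze q⟩

theorem closedFam_satFamily {S : Set ZFSet.{0}} (hS : GoodClass S) {M 𝓕 : ZFSet.{0}} (hM : M ∈ S)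
    (h1 : ∀ R ∈ 𝓕, ∃ (n : ℕ) (φ : Fml n), ∀ e, e ∈ R ↔ e ∈ Rel M n (Sat M.toSet φ))
    (h2 : ∀ (n : ℕ) (φ : Fml n), ∃ R ∈ 𝓕, ∀ e, e ∈ R ↔ e ∈ Rel M n (Sat M.toSet φ)) :
    ClosedFam S M 𝓕 := by
  have hfalse : ∀ n e, ¬ e ∈ Rel M n (Sat M.toSet (falseFml n)) := fun n e ⟨v, _, _, h⟩ =>
    sat_falseFml v h
  constructor
  · obtain ⟨R, hR, h⟩ := h2 0 (.not (falseFml 0))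
    refine ⟨R, hR, fun e _ => (h e).trans ⟨?_, ?_⟩⟩
    · rintro ⟨v, -, rfl, -⟩
      exact env_zero v
    · rintro rfl
      exact ⟨Fin.elim0, fun i => i.elim0, (env_zero _).symm, sat_falseFml _⟩
  · intro R₀ hR₀
    obtain ⟨n, φ, hφ⟩ := h1 R₀ hR₀
    obtain ⟨R, hR, h⟩ := h2 (n + 1) (ren Fin.succ φ)
    refine ⟨R, hR, fun p _ => (h p).trans ?_⟩
    rw [mem_Rel_succ]
    refine exists_congr fun x => and_congr_right fun _ => exists_congr fun e => ?_
    simp only [sat_ren, Fin.cons_succ, hφ]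
    exact and_comm
  · intro R₀ hR₀
    obtain ⟨n, φ, hφ⟩ := h1 R₀ hR₀
    match n, φ, hφ with
    | 0, φ, hφ =>
      obtain ⟨R, hR, h⟩ := h2 0 (falseFml 0)
      refine ⟨R, hR, fun p _ => iff_of_false (fun hp => hfalse _ _ ((h p).1 hp)) ?_⟩
      rintro ⟨x, _, y, _, e, _, _, hp⟩
      obtain ⟨v, -, hv, -⟩ := (hφ _).1 hp
      exact pair_ne_empty _ _ (hv.trans (env_zero v))
    | 1, φ, hφ =>
      obtain ⟨R, hR, h⟩ := h2 0 (falseFml 0)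
      refine ⟨R, hR, fun p _ => iff_of_false (fun hp => hfalse _ _ ((h p).1 hp)) ?_⟩
      rintro ⟨x, _, y, _, e, _, _, hp⟩
      obtain ⟨_, v, -, hv, -⟩ := pair_mem_Rel.1 ((hφ _).1 hp)
      exact pair_ne_empty _ _ (hv.trans (env_zero v))
    | n + 2, φ, hφ =>
      obtain ⟨R, hR, h⟩ := h2 (n + 2) (ren (Fin.cons 1 (Fin.cons 0 fun i => i.succ.succ)) φ)
      have hperm : ∀ w : Fin (n + 2) → ZFSet.{0},
          (fun i => w ((Fin.cons 1 (Fin.cons 0 fun i => i.succ.succ) :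
            Fin (n + 2) → Fin (n + 2)) i)) =
          Fin.cons (w 1) (Fin.cons (w 0) fun i => w i.succ.succ) := by
        intro w
        funext i
        refine Fin.cases rfl (fun i => Fin.cases rfl (fun _ => rfl) i) i
      refine ⟨R, hR, fun p _ => (h p).trans ⟨?_, ?_⟩⟩
      · intro hp
        obtain ⟨x, hx, e, rfl, hp'⟩ := mem_Rel_succ.1 hp
        obtain ⟨y, hy, e, rfl, hp''⟩ := mem_Rel_succ.1 hp'
        refine ⟨x, hS.trans M hM x hx, y, hS.trans M hM y hy, e,
          ClosedFam.rel_sub hS hM hp'', rfl, ?_⟩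
        rw [hφ, pair_mem_Rel, pair_mem_Rel]
        simp only [sat_ren, hperm] at hp''
        exact ⟨hy, hx, hp''⟩
      · rintro ⟨x, _, y, _, e, _, rfl, hp⟩
        rw [hφ, pair_mem_Rel, pair_mem_Rel] at hp
        rw [pair_mem_Rel, pair_mem_Rel]
        simp only [sat_ren, hperm]
        exact ⟨hp.2.1, hp.1, hp.2.2⟩
  · intro R₀ hR₀
    obtain ⟨n, φ, hφ⟩ := h1 R₀ hR₀
    obtain ⟨R, hR, h⟩ := h2 (n + 2) (.and (.mem 0 1) (ren (fun i => i.succ.succ) φ))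
    have hsat : ∀ w, Sat M.toSet (.and (.mem 0 1) (ren (fun i => i.succ.succ) φ)) w ↔
        w 0 ∈ w 1 ∧ Sat M.toSet φ fun i => w i.succ.succ := fun w =>
      and_congr Iff.rfl (sat_ren _ _ _ _)
    refine ⟨R, hR, fun p _ => (h p).trans ?_⟩
    rw [show Sat M.toSet _ = _ from funext fun w => propext (hsat w)]
    constructor
    · intro hp
      obtain ⟨x, hx, e, rfl, hp'⟩ := mem_Rel_succ.1 hp
      obtain ⟨y, hy, e, rfl, v, a, b, c, d⟩ := mem_Rel_succ.1 hp'
      exact ⟨x, hx, y, hy, e, (hφ e).2 ⟨v, a, b, d⟩, c, rfl⟩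
    · rintro ⟨x, hx, y, hy, e, he, hxy, rfl⟩
      obtain ⟨v, a, b, d⟩ := (hφ e).1 he
      rw [pair_mem_Rel, pair_mem_Rel]
      exact ⟨hx, hy, v, a, b, hxy, d⟩
  · intro R₀ hR₀
    obtain ⟨n, φ, hφ⟩ := h1 R₀ hR₀
    obtain ⟨R, hR, h⟩ := h2 (n + 2) (.and (.eq 0 1) (ren (fun i => i.succ.succ) φ))
    have hsat : ∀ w, Sat M.toSet (.and (.eq 0 1) (ren (fun i => i.succ.succ) φ)) w ↔
        w 0 = w 1 ∧ Sat M.toSet φ fun i => w i.succ.succ := fun w =>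
      and_congr Iff.rfl (sat_ren _ _ _ _)
    refine ⟨R, hR, fun p _ => (h p).trans ?_⟩
    rw [show Sat M.toSet _ = _ from funext fun w => propext (hsat w)]
    constructor
    · intro hp
      obtain ⟨x, hx, e, rfl, hp'⟩ := mem_Rel_succ.1 hp
      obtain ⟨y, hy, e, rfl, v, a, b, c, d⟩ := mem_Rel_succ.1 hp'
      have c' : x = y := c
      subst c'
      exact ⟨x, hx, e, (hφ e).2 ⟨v, a, b, d⟩, rfl⟩
    · rintro ⟨x, hx, e, he, rfl⟩
      obtain ⟨v, a, b, d⟩ := (hφ e).1 he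
      rw [pair_mem_Rel, pair_mem_Rel]
      exact ⟨hx, hx, v, a, b, rfl, d⟩
  · intro R₀ hR₀ R₁ hR₁
    obtain ⟨n, φ, hφ⟩ := h1 R₀ hR₀
    obtain ⟨m, ψ, hψ⟩ := h1 R₁ hR₁
    by_cases hnm : n = m
    · subst hnm
      obtain ⟨R, hR, h⟩ := h2 n (.and φ (.not ψ))
      refine ⟨R, hR, fun p _ => (h p).trans ?_⟩
      rw [hφ, hψ]
      constructor
      · rintro ⟨v, a, rfl, b, c⟩
        exact ⟨⟨v, a, rfl, b⟩, fun hv => c (env_mem_Rel.1 hv).2⟩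
      · rintro ⟨⟨v, a, rfl, b⟩, c⟩
        exact ⟨v, a, rfl, b, fun hv => c ⟨v, a, rfl, hv⟩⟩
    · refine ⟨R₀, hR₀, fun p _ => ⟨fun hp => ⟨hp, fun hp' => ?_⟩, fun hp => hp.1⟩⟩
      obtain ⟨v, -, hv, -⟩ := (hφ p).1 hp
      obtain ⟨w, -, hw, -⟩ := (hψ p).1 hp'
      exact hnm (env_arity (hv.symm.trans hw))
  · intro R₀ hR₀
    obtain ⟨n, φ, hφ⟩ := h1 R₀ hR₀
    match n, φ, hφ with
    | 0, φ, hφ =>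
      obtain ⟨R, hR, h⟩ := h2 0 (falseFml 0)
      refine ⟨R, hR, fun p _ => iff_of_false (fun hp => hfalse _ _ ((h p).1 hp)) ?_⟩
      rintro ⟨x, _, hp⟩
      obtain ⟨v, -, hv, -⟩ := (hφ _).1 hp
      exact pair_ne_empty _ _ (hv.trans (env_zero v))
    | n + 1, φ, hφ =>
      obtain ⟨R, hR, h⟩ := h2 n (.ex φ)
      refine ⟨R, hR, fun p _ => (h p).trans ?_⟩
      simp only [hφ, pair_mem_Rel]
      constructor
      · rintro ⟨v, a, rfl, x, hx, b⟩
        exact ⟨x, hx, hx, v, a, rfl, b⟩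
      · rintro ⟨x, hx, -, v, a, rfl, b⟩
        exact ⟨v, a, rfl, x, hx, b⟩

theorem isDef_iff {S : Set ZFSet.{0}} (hS : GoodClass S) {M B : ZFSet.{0}} (hM : M ∈ S) :
    IsDef S M B ↔ B ∈ Dset M := by
  constructor
  · rintro ⟨hBM, h⟩
    obtain ⟨μ, hμ, hMμ, hsub⟩ := hS.local_HC M hM
    obtain ⟨𝓕, hF, h1, h2⟩ := exists_satFamily hμ hMμ
    obtain ⟨R, hR, e, _, hB⟩ := h 𝓕 (hsub hF) (closedFam_satFamily hS hM h1 h2)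
    obtain ⟨n, φ, hφ⟩ := h1 R hR
    by_cases hex : ∃ z, z ∈ B
    · obtain ⟨z, hz⟩ := hex
      have hzR := (hφ _).1 ((hB z (hBM z hz)).1 hz)
      match n, φ, hφ, hzR with
      | 0, φ, hφ, hzR =>
        obtain ⟨v, -, hv, -⟩ := hzR
        exact absurd (hv.trans (env_zero v)) (pair_ne_empty _ _)
      | n + 1, φ, hφ, hzR =>
        obtain ⟨-, v, hv, rfl, -⟩ := pair_mem_Rel.1 hzR
        refine mem_Dset.2 ⟨n, φ, v, hv, ZFSet.ext fun x => ?_⟩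
        rw [ZFSet.mem_sep]
        constructor
        · intro hx
          have := (hφ _).1 ((hB x (hBM x hx)).1 hx)
          exact ⟨hBM x hx, (env_mem_Rel.1 (pair_mem_Rel.1 this).2).2⟩
        · rintro ⟨hx, hs⟩
          exact (hB x hx).2 ((hφ _).2 (pair_mem_Rel.2 ⟨hx, v, hv, rfl, hs⟩))
    · refine mem_Dset.2 ⟨0, falseFml 1, Fin.elim0, fun i => i.elim0, ZFSet.ext fun x => ?_⟩
      rw [ZFSet.mem_sep]
      exact iff_of_false (fun hx => hex ⟨x, hx⟩) fun hx => sat_falseFml _ hx.2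
  · intro hB
    obtain ⟨n, φ, v, hv, rfl⟩ := mem_Dset.1 hB
    refine ⟨fun z hz => (ZFSet.mem_sep.1 hz).1, fun 𝓕 hF hcl => ?_⟩
    obtain ⟨R, hR, h⟩ := hcl.in_sat hS hM hF φ
    refine ⟨R, hR, env v, ClosedFam.env_mem hS hM hv, fun z hz => ?_⟩
    rw [h, pair_mem_Rel, env_mem_Rel, ZFSet.mem_sep]
    exact ⟨fun hs => ⟨hz, hv, hs.2⟩, fun hs => ⟨hz, hs.2.2⟩⟩

/-! ### Describing the failure of being an `L`-cardinal -/

/-- `c` is an attempt at computing the map `collapse u`. -/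
def RecC (S : Set ZFSet.{0}) (u c : ZFSet.{0}) : Prop :=
  ∀ y ∈ S, ∀ w ∈ S, ZFSet.pair y w ∈ c →
    (∀ z ∈ y, z ∈ u → ∃ g ∈ S, ZFSet.pair z g ∈ c) ∧
    ∀ t ∈ S, t ∈ w ↔ ∃ z ∈ y, z ∈ u ∧ ZFSet.pair z t ∈ c

/-- `h` is an attempt at computing the map `Lstage`. -/
def RecL (S : Set ZFSet.{0}) (h : ZFSet.{0}) : Prop :=
  ∀ δ ∈ S, ∀ N ∈ S, ZFSet.pair δ N ∈ h →
    (∀ ε ∈ δ, ∃ g ∈ S, ZFSet.pair ε g ∈ h) ∧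
    ∀ t ∈ S, t ∈ N ↔ ∃ ε ∈ δ, ∃ g ∈ S, ZFSet.pair ε g ∈ h ∧ IsDef S g t

/-- The description, inside `S`, of the fact that `collapse u γ` is not an `L`-cardinal. -/
def Bad (S : Set ZFSet.{0}) (u γ : ZFSet.{0}) : Prop :=
  ∃ c ∈ S, ∃ α ∈ S, ∃ h ∈ S, ∃ β ∈ S, ∃ N ∈ S, ∃ a ∈ α, ∃ f ∈ N,
    RecC S u c ∧ ZFSet.pair γ α ∈ c ∧ IsSurjF a α f ∧
      RecL S h ∧ IsOrd β ∧ ZFSet.pair β N ∈ h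

namespace Dfn

variable {S : Set ZFSet.{0}} {n : ℕ}

theorem recC (hS : ∀ x ∈ S, ∀ y ∈ x, y ∈ S) (i j : Fin n) :
    Dfn S n fun v => RecC S (v i) (v j) :=
  all (all ((pair_mem hS _ _ _).imp
    ((ball hS _ ((mem _ _).imp (ex (pair_mem hS _ _ _)))).and
      (all ((mem _ _).iff (bex hS _ ((mem _ _).and (pair_mem hS _ _ _))))))))

theorem recL (hS : ∀ x ∈ S, ∀ y ∈ x, y ∈ S) (i : Fin n) :
    Dfn S n fun v => RecL S (v i) :=
  all (all ((pair_mem hS _ _ _).imp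
    ((ball hS _ (ex (pair_mem hS _ _ _))).and
      (all ((mem _ _).iff (bex hS _ (ex ((pair_mem hS _ _ _).and (isDef hS _ _)))))))))

theorem bad (hS : ∀ x ∈ S, ∀ y ∈ x, y ∈ S) (i j : Fin n) :
    Dfn S n fun v => Bad S (v i) (v j) :=
  ex (ex (ex (ex (ex (bex hS _ (bex hS _
    ((recC hS _ _).and ((pair_mem hS _ _ _).and ((isSurjF hS _ _ _).and
      ((recL hS _).and ((isOrd hS _).and (pair_mem hS _ _ _))))))))))))

end Dfn

theorem RecC.eq_collapse {S : Set ZFSet.{0}} (hS : ∀ x ∈ S, ∀ y ∈ x, y ∈ S) {u c : ZFSet.{0}}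
    (h : RecC S u c) : ∀ y ∈ S, ∀ w ∈ S, ZFSet.pair y w ∈ c → w = collapse u y := by
  intro y
  induction y using ZFSet.inductionOn with
  | _ y ih =>
    intro hy w hw hp
    obtain ⟨h1, h2⟩ := h y hy w hw hp
    ext t
    rw [mem_collapse]
    constructor
    · intro ht
      have htS := hS w hw t ht
      obtain ⟨z, hz, hzu, hzt⟩ := (h2 t htS).1 ht
      exact ⟨z, hz, hzu, ih z hz (hS y hy z hz) t htS hzt⟩
    · rintro ⟨z, hz, hzu, rfl⟩
      obtain ⟨g, hg, hzg⟩ := h1 z hz hzu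
      obtain rfl := ih z hz (hS y hy z hz) g hg hzg
      exact (h2 _ hg).2 ⟨z, hz, hzu, hzg⟩

theorem GoodClass.subset_mem {S : Set ZFSet.{0}} (hS : GoodClass S) {x y : ZFSet.{0}}
    (hx : x ∈ S) (hy : y ⊆ x) : y ∈ S := by
  obtain ⟨μ, hμ, hxμ, hsub⟩ := hS.local_HC x hx
  exact hsub (HC.subset_mem hμ hxμ hy)

theorem RecL.eq_Lstage {S : Set ZFSet.{0}} (hS : GoodClass S) {h : ZFSet.{0}}
    (hh : RecL S h) : ∀ δ ∈ S, ∀ N ∈ S, ZFSet.pair δ N ∈ h → N = Lstage δ := by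
  intro δ
  induction δ using ZFSet.inductionOn with
  | _ δ ih =>
    intro hδ N hN hp
    obtain ⟨h1, h2⟩ := hh δ hδ N hN hp
    ext t
    rw [mem_Lstage]
    constructor
    · intro ht
      obtain ⟨ε, hε, g, hg, hεg, hd⟩ := (h2 t (hS.trans N hN t ht)).1 ht
      refine ⟨ε, hε, ?_⟩
      rw [← ih ε hε (hS.trans δ hδ ε hε) g hg hεg]
      exact (isDef_iff hS hg).1 hd
    · rintro ⟨ε, hε, hd⟩
      obtain ⟨g, hg, hεg⟩ := h1 ε hε
      obtain rfl := ih ε hε (hS.trans δ hδ ε hε) g hg hεg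
      exact (h2 t (hS.subset_mem hg (subset_of_mem_Dset hd))).2
        ⟨ε, hε, _, hg, hεg, (isDef_iff hS hg).2 hd⟩

theorem Bad.not_LCard {S : Set ZFSet.{0}} (hS : GoodClass S) {u γ : ZFSet.{0}} (hγS : γ ∈ S)
    (hγ : IsOrd γ) (h : Bad S u γ) : ¬ LCard (collapse u γ) := by
  obtain ⟨c, hc, α, hα, h, hh, β, hβ, N, hN, a, ha, f, hf, hrc, hp, hs, hrl, ho, hp'⟩ := h
  obtain rfl := hrc.eq_collapse hS.trans γ hγS α hα hp
  obtain rfl := hrl.eq_Lstage hS β hβ N hN hp'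
  exact (not_LCard_iff (isOrd_collapse hγ)).2 ⟨a, f, β, ha, hs, ho, hf⟩

theorem mk_collapse_le (u x : ZFSet.{0}) : #(collapse u x).toSet ≤ #x.toSet := by
  have : (collapse u x).toSet ⊆ collapse u '' x.toSet := by
    intro w hw
    obtain ⟨z, hz, -, rfl⟩ := mem_collapse.1 hw
    exact ⟨z, hz, rfl⟩
  exact (mk_le_mk_of_subset this).trans mk_image_le

theorem HC.collapse {μ : ZFSet.{0}} (hμ : ℵ₀ ≤ #μ.toSet) (u : ZFSet.{0}) :
    ∀ x ∈ HC μ, collapse u x ∈ HC μ := by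
  intro x
  induction x using ZFSet.inductionOn with
  | _ x ih =>
    intro hx
    refine HC.of_subset hμ ?_ ((mk_collapse_le u x).trans (HC.card_le hx))
    intro w hw
    obtain ⟨z, hz, -, rfl⟩ := mem_collapse.1 hw
    exact ih z hz (HC.trans hx hz)

theorem HC.collapse_of_card_le {μ Y : ZFSet.{0}} (hμ : ℵ₀ ≤ #μ.toSet) (hY : #Y.toSet ≤ #μ.toSet)
    (x : ZFSet.{0}) : SRPPaper.collapse Y x ∈ HC μ := by
  have hT : collapseSet Y ∈ HC μ := by
    refine HC.of_transitive hμ ?_ ?_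
    · intro y hy w hw
      obtain ⟨z, -, rfl⟩ := mem_img.1 hy
      obtain ⟨t, -, ht, rfl⟩ := mem_collapse.1 hw
      exact mem_img.2 ⟨t, ht, rfl⟩
    · have : (collapseSet Y).toSet ⊆ SRPPaper.collapse Y '' Y.toSet := by
        intro w hw
        obtain ⟨z, hz, rfl⟩ := mem_img.1 hw
        exact ⟨z, hz, rfl⟩
      exact (mk_le_mk_of_subset this).trans (mk_image_le.trans hY)
  refine HC.subset_mem hμ hT fun w hw => ?_
  obtain ⟨t, -, ht, rfl⟩ := mem_collapse.1 hw
  exact mem_img.2 ⟨t, ht, rfl⟩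

theorem HC.exists_graph {μ δ : ZFSet.{0}} (hμ : ℵ₀ ≤ #μ.toSet) (hδ : δ ∈ HC μ)
    (g : ZFSet.{0} → ZFSet.{0}) (hg : ∀ y, y ∈ δ ∨ y = δ → g y ∈ HC μ) :
    ∃ c ∈ HC μ, ∀ p, p ∈ c ↔ ∃ y, (y ∈ δ ∨ y = δ) ∧ p = ZFSet.pair y (g y) := by
  refine HC.of_set hμ (X := {p | ∃ y, (y ∈ δ ∨ y = δ) ∧ p = ZFSet.pair y (g y)}) ?_ ?_
  · rintro _ ⟨y, hy, rfl⟩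
    refine HC.pair hμ ?_ (hg y hy)
    rcases hy with hy | rfl
    · exact HC.trans hδ hy
    · exact hδ
  · have : {p | ∃ y, (y ∈ δ ∨ y = δ) ∧ p = ZFSet.pair y (g y)} ⊆
        (fun y => ZFSet.pair y (g y)) '' insert δ δ.toSet := by
      rintro _ ⟨y, hy, rfl⟩
      exact ⟨y, hy.symm, rfl⟩
    refine (mk_le_mk_of_subset this).trans (mk_image_le.trans (mk_insert_le.trans ?_))
    exact (add_le_add (HC.card_le hδ) (one_le_aleph0.trans hμ)).trans (add_eq_self hμ).le

theorem bad_of_not_LCard {S : Set ZFSet.{0}} (hS : GoodClass S) {u γ : ZFSet.{0}}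
    (hγ : IsOrd γ) (hinf : ℵ₀ ≤ #γ.toSet) (hsub : HC γ ⊆ S) (h : ¬ LCard (collapse u γ)) :
    Bad S u γ := by
  have hα := isOrd_collapse (X := u) hγ
  have hγγ : γ ∈ HC γ := HC.of_transitive hinf hγ.1 le_rfl
  obtain ⟨a, f, β, hL⟩ := (not_LCard_iff hα).1 h
  obtain ⟨Y, hY, hAY, hcard⟩ := exists_rich (A := (collapse u γ).toSet ∪ {a, f, β}) hinf
    (((mk_union_le _ _).trans (add_le_add (mk_collapse_le u γ)
      (((Set.toFinite {a, f, β}).lt_aleph0.le).trans hinf))).trans (add_eq_self hinf).le)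
  have hfY : f ∈ Y := hAY f (by simp)
  have hβY : β ∈ Y := hAY β (by simp)
  have hsubY : collapse u γ ⊆ Y := fun z hz => hAY z (Or.inl hz)
  have hL' := LSurj.collapse hY (hAY a (by simp)) hfY hβY hL
  rw [collapse_eq_self _ hα.1 hsubY, collapse_eq_self a (hα.mem hL.1).1
    fun z hz => hsubY (hα.trans hL.1 hz)] at hL'
  have hHC := HC.collapse_of_card_le hinf hcard
  have hst : ∀ δ, δ ∈ collapse Y β ∨ δ = collapse Y β → Lstage δ ∈ HC γ := by
    have key : ∀ d ∈ Y, Lstage (collapse Y d) ∈ HC γ := fun d hd => by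
      rw [← hY.collapse_Lstage d hd]
      exact hHC _
    rintro δ (hδ | rfl)
    · obtain ⟨d, -, hd, rfl⟩ := mem_collapse.1 hδ
      exact key d hd
    · exact key β hβY
  obtain ⟨c, hc, hcm⟩ := HC.exists_graph hinf hγγ (collapse u) fun y hy => HC.collapse hinf u y <| by
    rcases hy with hy | rfl
    · exact HC.trans hγγ hy
    · exact hγγ
  obtain ⟨h, hh, hhm⟩ := HC.exists_graph hinf (hHC β) Lstage hst
  have hdown : ∀ η : ZFSet.{0}, IsOrd η → ∀ y, y ∈ η ∨ y = η → ∀ z ∈ y, z ∈ η := by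
    rintro η hη y (hy | rfl) z hz
    · exact hη.trans hy hz
    · exact hz
  refine ⟨c, hsub hc, _, hsub (HC.collapse hinf u γ hγγ), h, hsub hh, _, hsub (hHC β), _,
    hsub (hst _ (Or.inr rfl)), a, hL.1, _, hL'.2.2.2, ?_, (hcm _).2 ⟨γ, Or.inr rfl, rfl⟩,
    hL'.2.1, ?_, hL'.2.2.1, (hhm _).2 ⟨_, Or.inr rfl, rfl⟩⟩
  · intro y _ w _ hp
    obtain ⟨y', hy, he⟩ := (hcm _).1 hp
    obtain ⟨rfl, rfl⟩ := ZFSet.pair_inj.1 he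
    refine ⟨fun z hz _ => ⟨collapse u z, ?_, (hcm _).2 ⟨z, Or.inl (hdown γ hγ y hy z hz), rfl⟩⟩, ?_⟩
    · exact hsub (HC.collapse hinf u z (HC.trans hγγ (hdown γ hγ y hy z hz)))
    · intro t _
      rw [mem_collapse]
      refine exists_congr fun z => and_congr_right fun hz => and_congr_right fun _ => ?_
      rw [hcm]
      constructor
      · rintro rfl
        exact ⟨z, Or.inl (hdown γ hγ y hy z hz), rfl⟩
      · rintro ⟨z', -, he⟩
        obtain ⟨rfl, rfl⟩ := ZFSet.pair_inj.1 he
        rfl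
  · intro δ _ N _ hp
    obtain ⟨δ', hδ, he⟩ := (hhm _).1 hp
    obtain ⟨rfl, rfl⟩ := ZFSet.pair_inj.1 he
    have hd := hdown _ hL'.2.2.1 δ hδ
    refine ⟨fun ε hε => ⟨Lstage ε, hsub (hst ε (Or.inl (hd ε hε))),
      (hhm _).2 ⟨ε, Or.inl (hd ε hε), rfl⟩⟩, fun t _ => ?_⟩
    rw [mem_Lstage]
    refine exists_congr fun ε => and_congr_right fun hε => ?_
    constructor
    · intro ht
      have hg := hsub (hst ε (Or.inl (hd ε hε)))
      exact ⟨_, hg, (hhm _).2 ⟨ε, Or.inl (hd ε hε), rfl⟩, (isDef_iff hS hg).2 ht⟩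
    · rintro ⟨g, hg, hp, ht⟩
      obtain ⟨ε', -, he⟩ := (hhm _).1 hp
      obtain ⟨rfl, rfl⟩ := ZFSet.pair_inj.1 he
      exact (isDef_iff hS hg).1 ht

/-! ### The hypotheses on cardinals -/

theorem mk_ofNat (n : ℕ) : ZFSet.mk (PSet.ofNat.{0} n) = (n : Ordinal.{0}).toZFSet := by
  induction n with
  | zero => simp [PSet.ofNat]; rfl
  | succ n ih =>
    rw [Nat.cast_succ, Ordinal.toZFSet_add_one, ← ih]
    rfl

theorem omega_eq_toZFSet : ZFSet.omega.{0} = (Ordinal.omega0.{0}).toZFSet := by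
  ext x
  rw [Ordinal.mem_toZFSet_iff]
  constructor
  · intro hx
    induction x using Quotient.inductionOn with
    | _ x =>
      obtain ⟨n, hn⟩ := hx
      refine ⟨n.down, Ordinal.natCast_lt_omega0 _, ?_⟩
      rw [← mk_ofNat]
      exact (ZFSet.sound hn).symm
  · rintro ⟨a, ha, rfl⟩
    obtain ⟨n, rfl⟩ := Ordinal.lt_omega0.1 ha
    rw [← mk_ofNat]
    exact ⟨⟨n⟩, PSet.Equiv.refl _⟩

theorem isCard_toZFSet (c : Cardinal.{0}) : IsCard c.ord.toZFSet := by
  refine ⟨isOrd_iff.2 (ZFSet.isOrdinal_toZFSet _), ?_⟩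
  intro α hα ⟨e⟩
  obtain ⟨a, ha, rfl⟩ := Ordinal.mem_toZFSet_iff.1 hα
  have hc : #(a.toZFSet : Type 1) = #(c.ord.toZFSet : Type 1) := mk_congr e
  rw [ZFSet.cardinalMk_coe_sort, ZFSet.cardinalMk_coe_sort, lift_inj, Ordinal.card_toZFSet,
    Ordinal.card_toZFSet, card_ord] at hc
  exact (lt_ord.1 ha).ne hc

theorem omega_mem_aleph_one : ZFSet.omega ∈ Aleph 1 := by
  have h : ∃ α, (IsOrd α ∧ IsCard α ∧ ZFSet.omega ∈ α) ∧
      ∀ β ∈ α, ¬ (IsOrd β ∧ IsCard β ∧ ZFSet.omega ∈ β) := by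
    obtain ⟨α, hα, hmin⟩ := ZFSet.mem_wf.has_min
      {α : ZFSet.{0} | IsOrd α ∧ IsCard α ∧ ZFSet.omega ∈ α}
      ⟨_, (isCard_toZFSet (ℵ_ 1)).1, isCard_toZFSet (ℵ_ 1), by
        rw [omega_eq_toZFSet, Ordinal.toZFSet_mem_toZFSet_iff]
        simp⟩
    exact ⟨α, hα, fun β hβ hp => hmin β hp hβ⟩
  have : Aleph 1 = h.choose := dif_pos h
  rw [this]
  exact h.choose_spec.1.2.2

theorem mk_omega : #ZFSet.omega.{0}.toSet = ℵ₀ := by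
  have hc : #ZFSet.omega.{0}.toSet = lift.{1} ZFSet.omega.{0}.card := ZFSet.cardinalMk_coe_sort
  rw [hc, omega_eq_toZFSet, Ordinal.card_toZFSet]
  simp

theorem aleph0_le_of_aleph_one {γ : ZFSet.{0}} (hγ : IsOrd γ) (h : Aleph 1 ∈ γ ∨ Aleph 1 = γ) :
    ℵ₀ ≤ #γ.toSet := by
  have hω : ZFSet.omega ∈ γ := by
    rcases h with h | rfl
    · exact hγ.trans h omega_mem_aleph_one
    · exact omega_mem_aleph_one
  have hsub : ZFSet.omega.toSet ⊆ γ.toSet := fun z hz => hγ.trans hω hz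
  exact mk_omega.ge.trans (mk_le_mk_of_subset hsub)

theorem goodClass_Hset {κ γ : ZFSet.{0}} (hκ : IsOrd κ) (hγκ : γ ∈ κ) (hinf : ℵ₀ ≤ #γ.toSet) :
    GoodClass (Hset κ) := by
  have hmono : ∀ μ ∈ κ, ∀ ν ∈ κ, ∃ ρ ∈ κ, μ ⊆ ρ ∧ ν ⊆ ρ := by
    intro μ hμ ν hν
    rcases (isOrd_iff.1 (hκ.mem hμ)).subset_total (isOrd_iff.1 (hκ.mem hν)) with h | h
    · exact ⟨ν, hν, h, subset_rfl⟩
    · exact ⟨μ, hμ, subset_rfl, h⟩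
  have hle : ∀ {μ ρ : ZFSet.{0}}, μ ⊆ ρ → #μ.toSet ≤ #ρ.toSet := fun h =>
    mk_le_mk_of_subset fun z hz => h hz
  have key : ∀ x ∈ Hset κ, ∃ μ ∈ κ, ℵ₀ ≤ #μ.toSet ∧ x ∈ HC μ := by
    intro x hx
    obtain ⟨μ, hμ, hxμ⟩ := exists_HC_of_mem_Hset hx
    obtain ⟨ρ, hρ, h1, h2⟩ := hmono μ hμ γ hγκ
    exact ⟨ρ, hρ, hinf.trans (hle h2), HC.mono (hle h1) hxμ⟩
  refine ⟨fun x hx y hy => ?_, fun x hx => ?_, fun x hx y hy => ?_⟩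
  · obtain ⟨μ, hμ, -, hxμ⟩ := key x hx
    exact HC_subset_Hset hμ (HC.trans hxμ hy)
  · obtain ⟨μ, hμ, h, hxμ⟩ := key x hx
    exact ⟨μ, h, hxμ, HC_subset_Hset hμ⟩
  · obtain ⟨μ, hμ, h, hxμ⟩ := key x hx
    obtain ⟨ν, hν, -, hyν⟩ := key y hy
    obtain ⟨ρ, hρ, h1, h2⟩ := hmono μ hμ ν hν
    exact HC_subset_Hset hρ (HC.pair (h.trans (hle h1)) (HC.mono (hle h1) hxμ)
      (HC.mono (hle h2) hyν))

/-! ### Elementary submodels -/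

theorem ElemSub.exists {Z : ZFSet.{0}} {S : Set ZFSet.{0}} (hZ : ElemSub Z S) {n : ℕ}
    {R : (Fin (n + 1) → ZFSet.{0}) → Prop} (hR : Dfn S (n + 1) R) (v : Fin n → ZFSet.{0})
    (hv : ∀ i, v i ∈ Z) (h : ∃ x ∈ S, R (Fin.cons x v)) : ∃ x ∈ Z, R (Fin.cons x v) := by
  obtain ⟨φ, hφ⟩ := hR
  have hcons : ∀ x ∈ S, ∀ i, (Fin.cons x v : Fin (n + 1) → ZFSet.{0}) i ∈ S := fun x hx i =>
    Fin.cases hx (fun i => hZ.1 (hv i)) i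
  obtain ⟨x, hx, hR⟩ := h
  obtain ⟨y, hy, hs⟩ : Sat Z.toSet (.ex φ) v :=
    (hZ.2 (.ex φ) v hv).2 ⟨x, hx, (hφ _ (hcons x hx)).2 hR⟩
  refine ⟨y, hy, (hφ _ (hcons y (hZ.1 hy))).1 ((hZ.2 φ _ fun i => ?_).1 hs)⟩
  exact Fin.cases hy (fun i => hv i) i

theorem ElemSub.pair_mem {Z : ZFSet.{0}} {S : Set ZFSet.{0}} (hZ : ElemSub Z S)
    (hS : GoodClass S) {x y : ZFSet.{0}} (hx : x ∈ Z) (hy : y ∈ Z) : ZFSet.pair x y ∈ Z := by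
  obtain ⟨p, hp, he⟩ := hZ.exists (Dfn.eq_pair hS.trans (0 : Fin 3) 1 2) ![x, y]
    (by simp [Fin.forall_fin_two, hx, hy])
    ⟨_, hS.pair x (hZ.1 hx) y (hZ.1 hy), rfl⟩
  have he' : p = ZFSet.pair x y := he
  exact he' ▸ hp

theorem ElemSub.singleton_mem {Z : ZFSet.{0}} {S : Set ZFSet.{0}} (hZ : ElemSub Z S)
    (hS : GoodClass S) {x : ZFSet.{0}} (hx : x ∈ Z) : ({x} : ZFSet.{0}) ∈ Z := by
  obtain ⟨p, hp, he⟩ := hZ.exists (Dfn.eq_upair hS.trans (0 : Fin 2) 1 1) ![x]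
    (by simp [hx]) ⟨{x}, hS.trans _ (hS.pair x (hZ.1 hx) x (hZ.1 hx)) _ (by simp [ZFSet.pair]),
      by simp⟩
  have he' : p = {x} := by simpa using he
  exact he' ▸ hp

theorem ElemSub.infinite {Z : ZFSet.{0}} {S : Set ZFSet.{0}} (hZ : ElemSub Z S)
    (hS : GoodClass S) {x : ZFSet.{0}} (hx : x ∈ Z) : Z.toSet.Infinite := by
  intro hfin
  obtain ⟨y, hy, hmax⟩ := Set.exists_max_image Z.toSet ZFSet.rank hfin ⟨x, hx⟩
  have := hmax _ (hZ.singleton_mem hS hy)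
  rw [ZFSet.rank_singleton] at this
  exact absurd this (not_le.2 (Order.lt_succ _))

/-- The relations whose choice functions are Skolem functions for `(S, ∈)`. -/
def skolemPreds (S : Set ZFSet.{0}) : Set (List ZFSet.{0} → ZFSet.{0} → Prop) :=
  Set.range fun (q : Σ n : ℕ, Fml (n + 1)) (l : List ZFSet.{0}) (x : ZFSet.{0}) =>
    x ∈ S ∧ ∃ v, l = List.ofFn v ∧ Sat S q.2 (Fin.cons x v)

theorem skolemPreds_countable (S : Set ZFSet.{0}) : (skolemPreds S).Countable :=
  Set.countable_range _

theorem elemSub_of_Cl {S A : Set ZFSet.{0}} (hA : A ⊆ S) {X : ZFSet.{0}}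
    (hX : ∀ x, x ∈ X ↔ Cl (skolemPreds S) A x) : ElemSub X S := by
  have hsub : ∀ x, Cl (skolemPreds S) A x → x ∈ S := by
    intro x hx
    induction hx with
    | base h => exact hA h
    | step hp l _ h _ =>
      obtain ⟨q, rfl⟩ := hp
      exact h.choose_spec.1
  refine ⟨fun x hx => hsub x ((hX x).1 hx), fun φ v hv => ?_⟩
  have key : ∀ {n : ℕ} (φ : Fml n) (v : Fin n → ZFSet.{0}), (∀ i, v i ∈ X) →
      (Sat X.toSet φ v ↔ Sat S φ v) := by
    intro n φ
    induction φ with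
    | mem i j => exact fun _ _ => Iff.rfl
    | eq i j => exact fun _ _ => Iff.rfl
    | inA i => exact fun _ _ => Iff.rfl
    | inB i => exact fun _ _ => Iff.rfl
    | not φ ih => exact fun v hv => not_congr (ih v hv)
    | and φ ψ ih ih' => exact fun v hv => and_congr (ih v hv) (ih' v hv)
    | ex φ ih =>
      intro v hv
      have hcons : ∀ x ∈ X, ∀ i, (Fin.cons x v : Fin _ → ZFSet.{0}) i ∈ X := fun x hx i =>
        Fin.cases hx (fun i => hv i) i
      constructor
      · rintro ⟨x, hx, hs⟩
        exact ⟨x, hsub x ((hX x).1 hx), (ih _ (hcons x hx)).1 hs⟩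
      · rintro ⟨x, hx, hs⟩
        obtain ⟨w, hw, hwS, v', hv', hs'⟩ := Cl.exists (P := skolemPreds S) (A := A)
          ⟨⟨_, φ⟩, rfl⟩ (List.ofFn v) (by
            intro y hy
            obtain ⟨i, rfl⟩ := List.mem_ofFn.1 hy
            exact (hX _).1 (hv i)) ⟨x, hx, v, rfl, hs⟩
        obtain rfl := List.ofFn_injective hv'
        exact ⟨w, (hX w).2 hw, (ih _ (hcons w ((hX w).2 hw))).2 hs'⟩
  exact key φ v hv

/-! ### Coding the Skolem hull operation by a set -/

/-- `u` is a subset of `W` closed under pairing in `W` and under the operation coded by `F`. -/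
def ClosedUnder (W F u : ZFSet.{0}) : Prop :=
  (∀ z ∈ u, z ∈ W) ∧ (∀ z ∈ W, z = ∅ → z ∈ u) ∧
    (∀ p ∈ W, ∀ a ∈ u, ∀ b ∈ u, p = ZFSet.pair a b → p ∈ u) ∧
    ∀ p ∈ u, ∀ y ∈ W, ZFSet.pair p y ∈ F → y ∈ u

/-- `F` is single-valued on `W`. -/
def SingleValued (W F : ZFSet.{0}) : Prop :=
  ∀ p ∈ W, ∀ y ∈ W, ∀ z ∈ W, ZFSet.pair p y ∈ F → ZFSet.pair p z ∈ F → y = z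

namespace Dfn

variable {S : Set ZFSet.{0}} {n : ℕ}

theorem closedUnder (hS : ∀ x ∈ S, ∀ y ∈ x, y ∈ S) (i j k : Fin n) :
    Dfn S n fun v => ClosedUnder (v i) (v j) (v k) :=
  (ball hS _ (mem _ _)).and ((ball hS _ ((empty hS _).imp (mem _ _))).and
    ((ball hS _ (ball hS _ (ball hS _ ((eq_pair hS _ _ _).imp (mem _ _))))).and
      (ball hS _ (ball hS _ ((pair_mem hS _ _ _).imp (mem _ _))))))

theorem singleValued (hS : ∀ x ∈ S, ∀ y ∈ x, y ∈ S) (i j : Fin n) :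
    Dfn S n fun v => SingleValued (v i) (v j) :=
  ball hS _ (ball hS _ (ball hS _ ((pair_mem hS _ _ _).imp ((pair_mem hS _ _ _).imp (eq _ _)))))

end Dfn

theorem exists_reflecting {γ : ZFSet.{0}} (hγ : IsOrd γ) (hinf : ℵ₀ ≤ #γ.toSet)
    (hsrp : SRPL γ) : ∃ W ∈ HC γ, ∃ F ∈ HC γ, γ ⊆ W ∧ ∅ ∈ W ∧ SingleValued W F ∧
      (∀ p y, ZFSet.pair p y ∈ F → y ∈ W) ∧
      ∀ u, ClosedUnder W F u → u.toSet.Countable → LCard (collapse u γ) := by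
  obtain ⟨κ, hκ, hγκ, hsrp⟩ := hsrp
  have hS := goodClass_Hset hκ.1.1 hγκ hinf
  have hγγ : γ ∈ HC γ := HC.of_transitive hinf hγ.1 le_rfl
  have hγS : γ ∈ Hset κ := HC_subset_Hset hγκ hγγ
  have hωinf : ℵ₀ ≤ #ZFSet.omega.toSet := mk_omega.ge
  have hωle : #ZFSet.omega.toSet ≤ ℵ₀ := mk_omega.le
  have hulls : ∀ A : Set ZFSet.{0}, A.Countable → ∃ X : ZFSet.{0}, X.toSet.Countable ∧
      ∀ x, x ∈ X ↔ Cl (skolemPreds (Hset κ)) (insert γ A) x := by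
    intro A hA
    obtain ⟨X, hX, hc⟩ := exists_Cl_set (skolemPreds_countable (Hset κ)) (A := insert γ A)
      hωinf ((le_aleph0_iff_set_countable.2 (hA.insert γ)).trans hωinf)
    exact ⟨X, le_aleph0_iff_set_countable.1 (hc.trans hωle), hX⟩
  have henum : ∀ l : List ZFSet.{0}, ∃ e : ℕ → ZFSet.{0},
      ∀ x, Cl (skolemPreds (Hset κ)) (insert γ {a | a ∈ l}) x ↔ ∃ i, e i = x := by
    intro l
    obtain ⟨X, hXc, hX⟩ := hulls {a | a ∈ l} l.finite_toSet.countable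
    obtain ⟨e, he⟩ := hXc.exists_eq_range ⟨γ, (hX γ).2 (Cl.base (by simp))⟩
    exact ⟨e, fun x => (hX x).symm.trans (by rw [← mem_toSet, he]; rfl)⟩
  choose e he using henum
  let num : ℕ → ZFSet.{0} := fun i => enc (List.replicate i ∅)
  have hnum : ∀ i j, num i = num j → i = j := fun i j h => by
    simpa using congrArg List.length (enc_injective h)
  have hlist : #(List γ.toSet) ≤ #γ.toSet := (mk_list_le_max _).trans (max_le hinf le_rfl)
  have hl : ∀ l : List γ.toSet, enc (l.map Subtype.val) ∈ HC γ := fun l =>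
    HC.enc hinf _ fun x hx => by
      obtain ⟨y, -, rfl⟩ := List.mem_map.1 hx
      exact HC.trans hγγ y.2
  have hnumHC : ∀ i, num i ∈ HC γ := fun i => HC.enc hinf _ fun x hx => by
    rw [List.eq_of_mem_replicate hx]
    exact HC.empty hinf
  have hprod : #(ℕ × List γ.toSet) ≤ #γ.toSet := by
    rw [mk_prod, mk_nat, lift_aleph0, lift_id']
    exact (mul_le_mul' hinf hlist).trans (mul_eq_self hinf).le
  have hpair : ∀ q : ℕ × List γ.toSet,
      ZFSet.pair (num q.1) (enc (q.2.map Subtype.val)) ∈ HC γ := fun q =>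
    HC.pair hinf (hnumHC _) (hl _)
  have hunion : ∀ A B : Set ZFSet.{0}, #A ≤ #γ.toSet → #B ≤ #γ.toSet →
      #(A ∪ B : Set ZFSet.{0}) ≤ #γ.toSet := fun A B hA hB =>
    (mk_union_le _ _).trans ((add_le_add hA hB).trans (add_eq_self hinf).le)
  obtain ⟨W, hW, hWm⟩ := HC.of_set hinf (X := γ.toSet ∪
      ((Set.range fun l : List γ.toSet => enc (l.map Subtype.val)) ∪
      ((Set.range num) ∪ Set.range fun q : ℕ × List γ.toSet =>
        ZFSet.pair (num q.1) (enc (q.2.map Subtype.val))))) (by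
    rintro x (hx | ⟨l, rfl⟩ | ⟨i, rfl⟩ | ⟨q, rfl⟩)
    · exact HC.trans hγγ hx
    · exact hl l
    · exact hnumHC i
    · exact hpair q) (hunion _ _ le_rfl (hunion _ _ (mk_range_le.trans hlist)
      (hunion _ _ ((Set.countable_range num).le_aleph0.trans hinf) (mk_range_le.trans hprod))))
  obtain ⟨F, hF, hFm⟩ := HC.of_set hinf (X := {p | ∃ q : ℕ × List γ.toSet,
      p = ZFSet.pair (ZFSet.pair (num q.1) (enc (q.2.map Subtype.val)))
        (e (q.2.map Subtype.val) q.1) ∧ e (q.2.map Subtype.val) q.1 ∈ γ}) (by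
    rintro x ⟨q, rfl, hq⟩
    exact HC.pair hinf (hpair q) (HC.trans hγγ hq)) (by
    have : {p | ∃ q : ℕ × List γ.toSet,
      p = ZFSet.pair (ZFSet.pair (num q.1) (enc (q.2.map Subtype.val)))
        (e (q.2.map Subtype.val) q.1) ∧ e (q.2.map Subtype.val) q.1 ∈ γ} ⊆
      Set.range fun q : ℕ × List γ.toSet =>
        ZFSet.pair (ZFSet.pair (num q.1) (enc (q.2.map Subtype.val)))
          (e (q.2.map Subtype.val) q.1) := by
      rintro p ⟨q, rfl, -⟩
      exact ⟨q, rfl⟩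
    exact (mk_le_mk_of_subset this).trans (mk_range_le.trans hprod))
  have hγW : γ ⊆ W := fun z hz => (hWm z).2 (Or.inl hz)
  have h0W : ∅ ∈ W := (hWm ∅).2 (Or.inr (Or.inl ⟨[], rfl⟩))
  refine ⟨W, hW, F, hF, hγW, h0W, ?_, ?_, ?_⟩
  · intro p _ y _ z _ hpy hpz
    obtain ⟨q, hq, -⟩ := (hFm _).1 hpy
    obtain ⟨q', hq', -⟩ := (hFm _).1 hpz
    obtain ⟨h1, rfl⟩ := ZFSet.pair_inj.1 hq
    obtain ⟨h2, rfl⟩ := ZFSet.pair_inj.1 hq'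
    obtain ⟨h3, h4⟩ := ZFSet.pair_inj.1 (h1.symm.trans h2)
    rw [hnum _ _ h3, enc_injective h4]
  · intro p y hp
    obtain ⟨q, hq, hqγ⟩ := (hFm _).1 hp
    rw [(ZFSet.pair_inj.1 hq).2]
    exact hγW hqγ
  · intro u ⟨huW, hu0, hup, huF⟩ huc
    replace hu0 : ∅ ∈ u := hu0 ∅ h0W rfl
    obtain ⟨X, hXc, hX⟩ := hulls {z | z ∈ u ∧ z ∈ γ} (huc.mono fun z hz => hz.1)
    have hXS : ElemSub X (Hset κ) := elemSub_of_Cl (A := insert γ {z | z ∈ u ∧ z ∈ γ}) (by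
      rintro z (rfl | hz)
      · exact hγS
      · exact hS.trans γ hγS z hz.2) hX
    have hγX : γ ∈ X := (hX γ).2 (Cl.base (Or.inl rfl))
    have hcard : LCard (collapse X γ) := hsrp X hXS ⟨hXc, hXS.infinite hS hγX⟩ hγX
    rw [collapse_congr γ hγ.1 fun z hz => ⟨fun hzX => ?_, fun hzu =>
      (hX z).2 (Cl.base (Or.inr ⟨hzu, hz⟩))⟩] at hcard
    · exact hcard
    · obtain ⟨l, hlA, hzl⟩ := Cl.finite ((hX z).1 hzX)
      let l' : List γ.toSet := (l.filter fun a => a ∈ γ).attach.map fun a =>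
        ⟨a.1, mem_toSet.2 (by simpa using (List.mem_filter.1 a.2).2)⟩
      have hl' : l'.map Subtype.val = l.filter fun a => a ∈ γ := by
        simp [l', Function.comp_def]
      have hz' : Cl (skolemPreds (Hset κ)) (insert γ {a | a ∈ l'.map Subtype.val}) z := by
        refine Cl.mono (fun a ha => Cl.base ?_) hzl
        rcases hlA a ha with rfl | haγ
        · exact Or.inl rfl
        · refine Or.inr ?_
          rw [hl']
          exact List.mem_filter.2 ⟨ha, by simpa using haγ.2⟩
      obtain ⟨i, rfl⟩ := (he _ z).1 hz'
      have hnumu : ∀ i, num i ∈ u := by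
        intro i
        induction i with
        | zero => exact hu0
        | succ i ih =>
          exact hup _ ((hWm _).2 (Or.inr (Or.inr (Or.inl ⟨i + 1, rfl⟩)))) ∅ hu0 _ ih rfl
      have henc : ∀ k : List γ.toSet, (∀ a ∈ k, a.1 ∈ u) → enc (k.map Subtype.val) ∈ u := by
        intro k
        induction k with
        | nil => exact fun _ => hu0
        | cons a k ih =>
          intro hk
          exact hup _ ((hWm _).2 (Or.inr (Or.inl ⟨a :: k, rfl⟩))) a.1 (hk a (by simp)) _
            (ih fun b hb => hk b (by simp [hb])) rfl
      have hel : enc (l'.map Subtype.val) ∈ u := henc l' fun a ha => by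
        have ha' : a.1 ∈ l.filter fun a => a ∈ γ := by
          rw [← hl']
          exact List.mem_map_of_mem ha
        rcases hlA a.1 (List.mem_filter.1 ha').1 with h | h
        · exact absurd a.2 fun haγ : a.1 ∈ γ => ZFSet.mem_irrefl γ (by rwa [h] at haγ)
        · exact h.1
      exact huF _ (hup _ ((hWm _).2 (Or.inr (Or.inr (Or.inr ⟨(i, l'), rfl⟩)))) _ (hnumu i) _ hel rfl)
        _ (hγW hz) ((hFm _).2 ⟨(i, l'), rfl, hz⟩)

theorem exists_reflecting_all {γ : ZFSet.{0}} (hγ : IsOrd γ) (hinf : ℵ₀ ≤ #γ.toSet)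
    (hsrp : SRPL γ) : ∃ W ∈ HC γ, ∃ F ∈ HC γ, γ ⊆ W ∧ ∅ ∈ W ∧ SingleValued W F ∧
      ∀ u, ClosedUnder W F u → LCard (collapse u γ) := by
  obtain ⟨W, hW, F, hF, hγW, h0, hsv, hval, h⟩ := exists_reflecting hγ hinf hsrp
  refine ⟨W, hW, F, hF, hγW, h0, hsv, fun u hu => ?_⟩
  by_contra hcon
  obtain ⟨a, f, β, hs⟩ := (not_LCard_iff (isOrd_collapse hγ)).1 hcon
  obtain ⟨Y, hY, hAY, hc⟩ := exists_rich (A := {∅, u, γ, F, a, f, β}) mk_omega.ge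
    (((Set.toFinite {∅, u, γ, F, a, f, β}).lt_aleph0.le).trans mk_omega.ge)
  rw [mk_omega] at hc
  have huY : u ∈ Y := hAY u (by simp)
  have hγY : γ ∈ Y := hAY γ (by simp)
  have hs' := LSurj.collapse hY (hAY a (by simp)) (hAY f (by simp)) (hAY β (by simp)) hs
  rw [hY.collapse_collapse huY γ hγY] at hs'
  refine (not_LCard_iff (isOrd_collapse hγ)).2 ⟨_, _, _, hs'⟩ (h (Y ∩ u) ?_ ?_)
  · obtain ⟨h1, h2, h3, h4⟩ := hu
    refine ⟨fun z hz => h1 z (ZFSet.mem_inter.1 hz).2, ?_, ?_, ?_⟩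
    · rintro z hz rfl
      exact ZFSet.mem_inter.2 ⟨hAY ∅ (by simp), h2 ∅ hz rfl⟩
    · rintro p hp x hx y hy rfl
      rw [ZFSet.mem_inter] at hx hy ⊢
      exact ⟨hY.pair_mem hx.1 hy.1, h3 _ hp _ hx.2 _ hy.2 rfl⟩
    · intro p hp y hy hpy
      rw [ZFSet.mem_inter] at hp ⊢
      obtain ⟨w, hw, hpw⟩ := hY.app F (hAY F (by simp)) p hp.1 ⟨y, hpy⟩
      obtain rfl := hsv p (h1 p hp.2) y hy w (hval p w hpw) hpy hpw
      exact ⟨hw, h4 p hp.2 _ hy hpy⟩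
  · refine (le_aleph0_iff_set_countable.1 hc).mono fun z hz => (ZFSet.mem_inter.1 hz).1

/-- The statement, in `S`, that `W` and `F` witness the reflection property of `γ`. -/
def Reflects (S : Set ZFSet.{0}) (W F γ : ZFSet.{0}) : Prop :=
  (∀ z ∈ γ, z ∈ W) ∧ (∃ z ∈ W, z = ∅) ∧ SingleValued W F ∧
    ∀ u ∈ S, ClosedUnder W F u → ¬ Bad S u γ

theorem Dfn.reflects {S : Set ZFSet.{0}} {n : ℕ} (hS : ∀ x ∈ S, ∀ y ∈ x, y ∈ S)
    (i j k : Fin n) : Dfn S n fun v => Reflects S (v i) (v j) (v k) :=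
  (ball hS _ (mem _ _)).and ((bex hS _ (empty hS _)).and ((singleValued hS _ _).and
    (all ((closedUnder hS _ _ _).imp (bad hS _ _).not))))

theorem LCard_collapse_of_elemSub {γ κ Z : ZFSet.{0}} (hγ : IsOrd γ) (hinf : ℵ₀ ≤ #γ.toSet)
    (hκ : IsOrd κ) (hγκ : γ ∈ κ) (hsrp : SRPL γ) (hZ : ElemSub Z (Hset κ)) (hmem : γ ∈ Z) :
    LCard (collapse Z γ) := by
  have hS := goodClass_Hset hκ hγκ hinf
  have hsub := HC_subset_Hset hγκ
  obtain ⟨W₀, hW₀, F₀, hF₀, hγW₀, h0₀, hsv₀, h₀⟩ := exists_reflecting_all hγ hinf hsrp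
  have hR₀ : Reflects (Hset κ) W₀ F₀ γ := ⟨fun z hz => hγW₀ hz, ⟨∅, h0₀, rfl⟩, hsv₀,
    fun u _ hu hb => hb.not_LCard hS (hZ.1 hmem) hγ (h₀ u hu)⟩
  obtain ⟨W, hWZ, hW⟩ := hZ.exists (R := fun w => ∃ F ∈ Hset κ, Reflects (Hset κ) (w 0) F (w 1))
    (Dfn.ex (P := fun F w => Reflects (Hset κ) (w 0) F (w 1)) (Dfn.reflects hS.trans 1 0 2))
    ![γ] (by simp [hmem]) ⟨W₀, hsub hW₀, F₀, hsub hF₀, hR₀⟩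
  obtain ⟨F, hFZ, hγW, ⟨z₀, hz₀, rfl⟩, hsv, hF⟩ := hZ.exists
    (R := fun w => Reflects (Hset κ) (w 1) (w 0) (w 2)) (Dfn.reflects hS.trans 1 0 2)
    ![W, γ] (by simp [Fin.forall_fin_two, hWZ, hmem]) hW
  change ∀ z ∈ γ, z ∈ W at hγW
  change ∅ ∈ W at hz₀
  change SingleValued W F at hsv
  change ∀ u ∈ Hset κ, ClosedUnder W F u → ¬ Bad (Hset κ) u γ at hF
  have hWS := hZ.1 hWZ
  have hu : ClosedUnder W F (Z ∩ W) := by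
    refine ⟨fun z hz => (ZFSet.mem_inter.1 hz).2, ?_, ?_, ?_⟩
    · rintro z hz rfl
      obtain ⟨x, hx, hx0⟩ := hZ.exists (Dfn.empty hS.trans (0 : Fin 1)) Fin.elim0
        (fun i => i.elim0) ⟨∅, hS.trans W hWS _ hz, rfl⟩
      have hx0' : x = ∅ := hx0
      exact ZFSet.mem_inter.2 ⟨hx0' ▸ hx, hz⟩
    · rintro p hp x hx y hy rfl
      rw [ZFSet.mem_inter] at hx hy ⊢
      exact ⟨hZ.pair_mem hS hx.1 hy.1, hp⟩
    · intro p hp y hy hpy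
      rw [ZFSet.mem_inter] at hp ⊢
      obtain ⟨w, hwZ, hw, hpw⟩ := hZ.exists (R := fun w => w 0 ∈ w 1 ∧ ZFSet.pair (w 2) (w 0) ∈ w 3)
        ((Dfn.mem 0 1).and (Dfn.pair_mem hS.trans 2 0 3)) ![W, p, F]
        (by simp [Fin.forall_fin_succ, hWZ, hp.1, hFZ]) ⟨y, hS.trans W hWS y hy, hy, hpy⟩
      obtain rfl := hsv p hp.2 y hy w hw hpy hpw
      exact ⟨hwZ, hy⟩
  have huS : Z ∩ W ∈ Hset κ := hS.subset_mem hWS fun z hz => (ZFSet.mem_inter.1 hz).2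
  rw [collapse_congr (Y := Z ∩ W) γ hγ.1 fun z hz => by
    rw [ZFSet.mem_inter]
    exact ⟨fun h => ⟨h, hγW z hz⟩, fun h => h.1⟩]
  by_contra hcon
  exact hF _ huS hu (bad_of_not_LCard hS hγ hinf hsub hcon)

/-- Proposition 2.11: under `SRP^L(γ)`, elementary submodels of size `≤ ω₁`
also collapse `γ` to an `L`-cardinal. -/
theorem statement4 (γ κ Z : ZFSet.{0}) (hγ : Aleph 1 ∈ γ ∨ Aleph 1 = γ) (hL : LCard γ)
    (hκ : IsRegular κ) (hγκ : γ ∈ κ) (hsrp : SRPL γ)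
    (hZ : ElemSub Z (Hset κ)) (hsize : CardLE Z (Aleph 1)) (hmem : γ ∈ Z) :
    LCard (collapse Z γ) := by
  exact LCard_collapse_of_elemSub hL.1 (aleph0_le_of_aleph_one hL.1 hγ) hκ.1.1 hγκ hsrp hZ hmem

end SRPPaper
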